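/- arXiv:0712.1275 — 3 statements merged into one kernel-verified Lean document; each statement's English description precedes it below -/
import Mathlib

section
/- For every set E ⊆ Ω, the infimum defining UpProb(E) is unchanged if the requirement liminf_{t→∞} S_t(ω) ≥ 1_E(ω) for all ω is replaced by the requirement sup_{t∈[0,∞)} S_t(ω) ≥ 1_E(ω) for all ω; that is, the two definitions of upper probability are equivalent. -/
open Filter Topology MeasureTheory
open scoped ENNReal NNReal

namespace GTP

/-- The sample space `Ω`: all continuous functions `ω : [0,∞) → ℝ`. -/
def Omega : Type := {f : ℝ≥0 → ℝ // Continuous f}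

/-- The filtration: `F t` is the smallest σ-algebra on `Ω` making all maps
`ω ↦ ω s`, `s ∈ [0,t]`, measurable. -/
def F (t : ℝ≥0) : MeasurableSpace Omega :=
  ⨆ s : {s : ℝ≥0 // s ≤ t},
    MeasurableSpace.comap (fun ω : Omega => ω.1 s.1) inferInstance

/-- A stopping time relative to the filtration `(F t)`, with values in `[0,∞]`. -/
def IsStopping (τ : Omega → ℝ≥0∞) : Prop :=
  ∀ t : ℝ≥0, MeasurableSet[F t] {ω : Omega | τ ω ≤ (t : ℝ≥0∞)}

/-- `F_τ`-measurability of a function `h : Ω → ℝ`. -/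
def MeasurableAtTime (τ : Omega → ℝ≥0∞) (h : Omega → ℝ) : Prop :=
  ∀ B : Set ℝ, MeasurableSet B → ∀ t : ℝ≥0,
    MeasurableSet[F t] (h ⁻¹' B ∩ {ω : Omega | τ ω ≤ (t : ℝ≥0∞)})

/-- An elementary trading strategy: an increasing sequence of stopping times
`τ₁ ≤ τ₂ ≤ ⋯` tending to `∞`, together with bounded `F_{τ_n}`-measurable
portfolio functions `h_n`. -/
structure ElemStrategy where
  τ : ℕ → Omega → ℝ≥0∞
  stopping : ∀ n, IsStopping (τ n)
  mono : ∀ n ω, τ n ω ≤ τ (n + 1) ω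
  tendsto_top : ∀ ω, Tendsto (fun n => τ n ω) atTop (𝓝 ⊤)
  h : ℕ → Omega → ℝ
  h_bdd : ∀ n, ∃ C : ℝ, ∀ ω, |h n ω| ≤ C
  h_meas : ∀ n, MeasurableAtTime (τ n) (h n)

/-- The time `τ ∧ t` as an element of `[0,∞)`. -/
noncomputable def clip (τ : Omega → ℝ≥0∞) (t : ℝ≥0) (ω : Omega) : ℝ≥0 :=
  (min (τ ω) (t : ℝ≥0∞)).toNNReal

/-- The elementary capital process
`K_t(ω) := c + Σ_n h_n(ω) (ω(τ_{n+1} ∧ t) − ω(τ_n ∧ t))`. -/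
noncomputable def elemCapital (G : ElemStrategy) (c : ℝ) (t : ℝ≥0) (ω : Omega) : ℝ :=
  c + ∑' n : ℕ, G.h n ω * (ω.1 (clip (G.τ (n + 1)) t ω) - ω.1 (clip (G.τ n) t ω))

/-- A positive capital process: a countable sum of nonnegative elementary capital
processes with strictly positive summable initial capitals. -/
structure PosCapital where
  G : ℕ → ElemStrategy
  c : ℕ → ℝ
  c_pos : ∀ n, 0 < c n
  c_summable : Summable c
  nonneg : ∀ n t ω, 0 ≤ elemCapital (G n) (c n) t ω

/-- The value `S_t(ω) ∈ [0,∞]` of a positive capital process. -/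
noncomputable def PosCapital.value (S : PosCapital) (t : ℝ≥0) (ω : Omega) : ℝ≥0∞ :=
  ∑' n : ℕ, ENNReal.ofReal (elemCapital (S.G n) (S.c n) t ω)

/-- The initial value `S_0` of a positive capital process (independent of `ω`,
since `K^{G_n,c_n}_0 = c_n`). -/
noncomputable def PosCapital.init (S : PosCapital) : ℝ≥0∞ :=
  ∑' n : ℕ, ENNReal.ofReal (S.c n)

/-- Upper probability:
`UpProb(E) := inf { S₀ : S a positive capital process, liminf_{t→∞} S_t ≥ 1_E }`. -/
noncomputable def UpProb (E : Set Omega) : ℝ≥0∞ :=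
  ⨅ (S : PosCapital) (_ : ∀ ω : Omega,
      E.indicator (fun _ => (1 : ℝ≥0∞)) ω ≤ liminf (fun t : ℝ≥0 => S.value t ω) atTop),
    S.init

/-- A set is null if its upper probability is `0`. -/
def IsNull (E : Set Omega) : Prop := UpProb E = 0

/-- Upper probability defined with `sup_{t ∈ [0,∞)} S_t(ω)` in place of
`liminf_{t→∞} S_t(ω)`. -/
noncomputable def UpProbSup (E : Set Omega) : ℝ≥0∞ :=
  ⨅ (S : PosCapital) (_ : ∀ ω : Omega,
      E.indicator (fun _ => (1 : ℝ≥0∞)) ω ≤ ⨆ t : ℝ≥0, S.value t ω),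
    S.init

lemma F_mono_s1 {s t : ℝ≥0} (h : s ≤ t) : F s ≤ F t :=
  iSup_le fun u => le_iSup_of_le (⟨u.1, u.2.trans h⟩ : {s : ℝ≥0 // s ≤ t}) le_rfl

lemma meas_eval {s t : ℝ≥0} (h : s ≤ t) : Measurable[F t] (fun ω : Omega => ω.1 s) := by
  have h1 : MeasurableSpace.comap (fun ω : Omega => ω.1 s) inferInstance ≤ F t :=
    le_iSup_of_le (⟨s, h⟩ : {s : ℝ≥0 // s ≤ t}) le_rfl
  intro B hB
  exact h1 _ ⟨B, hB, rfl⟩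

lemma IsStopping.le_of_le {τ : Omega → ℝ≥0∞} (h : IsStopping τ) {s t : ℝ≥0} (hst : s ≤ t) :
    MeasurableSet[F t] {ω : Omega | τ ω ≤ (s : ℝ≥0∞)} := F_mono_s1 hst _ (h s)

/-- The σ-algebra at a stopping time. -/
def Fst (τ : Omega → ℝ≥0∞) (hτ : IsStopping τ) : MeasurableSpace Omega where
  MeasurableSet' s := ∀ t : ℝ≥0, MeasurableSet[F t] (s ∩ {ω : Omega | τ ω ≤ (t : ℝ≥0∞)})
  measurableSet_empty := by
    intro t
    rw [Set.empty_inter]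
    exact @MeasurableSet.empty _ (F t)
  measurableSet_compl := by
    intro s hs t
    have : sᶜ ∩ {ω : Omega | τ ω ≤ (t : ℝ≥0∞)} =
      {ω : Omega | τ ω ≤ (t : ℝ≥0∞)} \ (s ∩ {ω : Omega | τ ω ≤ (t : ℝ≥0∞)}) := by
      ext ω; simp; tauto
    rw [this]
    exact @MeasurableSet.diff _ (F t) _ _ (hτ t) (hs t)
  measurableSet_iUnion := by
    intro f hf t
    rw [Set.iUnion_inter]
    exact @MeasurableSet.iUnion _ _ (F t) _ _ (fun i => hf i t)

lemma measAt_iff {τ : Omega → ℝ≥0∞} (hτ : IsStopping τ) {h : Omega → ℝ} :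
    MeasurableAtTime τ h ↔ Measurable[Fst τ hτ] h :=
  ⟨fun H _ hB => H _ hB, fun H _ hB => H hB⟩

lemma stopping_top : IsStopping (fun _ => ⊤) := by
  intro t
  simp

lemma stopping_zero : IsStopping (fun _ => 0) := by
  intro t
  simp

lemma stopping_max {σ τ : Omega → ℝ≥0∞} (hσ : IsStopping σ) (hτ : IsStopping τ) :
    IsStopping (fun ω => max (σ ω) (τ ω)) := by
  intro t
  simp only [max_le_iff]
  exact @MeasurableSet.inter _ (F t) _ _ (hσ t) (hτ t)

lemma stopping_min {σ τ : Omega → ℝ≥0∞} (hσ : IsStopping σ) (hτ : IsStopping τ) :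
    IsStopping (fun ω => min (σ ω) (τ ω)) := by
  intro t
  simp only [min_le_iff]
  exact @MeasurableSet.union _ (F t) _ _ (hσ t) (hτ t)

lemma meas_lt_le {ρ σ : Omega → ℝ≥0∞} (hρ : IsStopping ρ) (hσ : IsStopping σ) (t : ℝ≥0) :
    MeasurableSet[F t] {ω : Omega | ρ ω < σ ω ∧ σ ω ≤ t} := by
  have : {ω : Omega | ρ ω < σ ω ∧ σ ω ≤ t} = ⋃ q : ℚ,
      ({ω : Omega | ρ ω ≤ (min (Real.toNNReal q) t : ℝ≥0)} ∩
        {ω : Omega | σ ω ≤ (min (Real.toNNReal q) t : ℝ≥0)}ᶜ) ∩ {ω : Omega | σ ω ≤ t} := by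
    ext ω
    simp only [Set.mem_ofPred_eq, Set.mem_iUnion, Set.mem_inter_iff, Set.mem_compl_iff, not_le]
    constructor
    · rintro ⟨h1, h2⟩
      obtain ⟨q, -, hq1, hq2⟩ := ENNReal.lt_iff_exists_rat_btwn.1 h1
      have hle : Real.toNNReal q ≤ t := by exact_mod_cast (hq2.trans_le h2).le
      exact ⟨q, ⟨by rw [min_eq_left hle]; exact hq1.le, by rw [min_eq_left hle]; exact hq2⟩, h2⟩
    · rintro ⟨q, ⟨h1, h2⟩, h3⟩
      exact ⟨h1.trans_lt h2, h3⟩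
  rw [this]
  let _ := F t
  exact MeasurableSet.iUnion fun q =>
    ((hρ.le_of_le (min_le_right _ _)).inter (hσ.le_of_le (min_le_right _ _)).compl).inter (hσ t)

/-- `{ρ < σ}` belongs to `F_ρ`. -/
lemma meas_lt {ρ σ : Omega → ℝ≥0∞} (hρ : IsStopping ρ) (hσ : IsStopping σ) :
    MeasurableSet[Fst ρ hρ] {ω : Omega | ρ ω < σ ω} := by
  intro t
  have : {ω : Omega | ρ ω < σ ω} ∩ {ω : Omega | ρ ω ≤ t} =
    {ω : Omega | ρ ω ≤ t} ∩ ({ω : Omega | σ ω ≤ t}ᶜ ∪ {ω : Omega | ρ ω < σ ω ∧ σ ω ≤ t}) := by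
    ext ω
    simp only [Set.mem_ofPred_eq, Set.mem_inter_iff, Set.mem_compl_iff, not_le, Set.mem_union]
    constructor
    · rintro ⟨h1, h2⟩
      refine ⟨h2, ?_⟩
      rcases le_or_gt (σ ω) t with h | h
      · exact Or.inr ⟨h1, h⟩
      · exact Or.inl h
    · rintro ⟨h1, h2 | h2⟩
      · exact ⟨h1.trans_lt h2, h1⟩
      · exact ⟨h2.1, h1⟩
  rw [this]
  let _ := F t
  exact (hρ t).inter ((hσ t).compl.union (meas_lt_le hρ hσ t))

/-- `{σ ≤ ρ}` belongs to `F_ρ`. -/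
lemma meas_le {ρ σ : Omega → ℝ≥0∞} (hρ : IsStopping ρ) (hσ : IsStopping σ) :
    MeasurableSet[Fst ρ hρ] {ω : Omega | σ ω ≤ ρ ω} := by
  have := @MeasurableSet.compl _ _ (Fst ρ hρ) (meas_lt hρ hσ)
  convert this using 1
  ext ω; simp

open Classical in
lemma stopping_next {ρ σ : Omega → ℝ≥0∞} (hρ : IsStopping ρ) (hσ : IsStopping σ) :
    IsStopping (fun ω => if ρ ω < σ ω then σ ω else ⊤) := by
  intro t
  convert meas_lt_le hρ hσ t using 1
  ext ω
  simp only [Set.mem_ofPred_eq]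
  split_ifs with h <;> simp [h]

/-- Restricting an `F_σ`-measurable function to `{σ ≤ ρ}` gives an `F_ρ`-measurable one. -/
lemma meas_indicator {ρ σ : Omega → ℝ≥0∞} (hρ : IsStopping ρ) (hσ : IsStopping σ)
    {h : Omega → ℝ} (hh : MeasurableAtTime σ h) :
    Measurable[Fst ρ hρ] ({ω : Omega | σ ω ≤ ρ ω}.indicator h) := by
  intro B hB
  have key : MeasurableSet[Fst ρ hρ] (h ⁻¹' B ∩ {ω : Omega | σ ω ≤ ρ ω}) := by
    intro t
    have : h ⁻¹' B ∩ {ω : Omega | σ ω ≤ ρ ω} ∩ {ω : Omega | ρ ω ≤ t} =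
      (h ⁻¹' B ∩ {ω : Omega | σ ω ≤ t}) ∩
        ({ω : Omega | σ ω ≤ ρ ω} ∩ {ω : Omega | ρ ω ≤ t}) := by
      ext ω
      simp only [Set.mem_ofPred_eq, Set.mem_inter_iff]
      constructor
      · rintro ⟨⟨h1, h2⟩, h3⟩
        exact ⟨⟨h1, h2.trans h3⟩, h2, h3⟩
      · rintro ⟨⟨h1, -⟩, h2, h3⟩
        exact ⟨⟨h1, h2⟩, h3⟩
    rw [this]
    exact @MeasurableSet.inter _ (F t) _ _ (hh B hB t) (meas_le hρ hσ t)
  have hS := meas_le hρ hσ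
  let _ := Fst ρ hρ
  by_cases h0 : (0 : ℝ) ∈ B
  · have : {ω : Omega | σ ω ≤ ρ ω}.indicator h ⁻¹' B =
      (h ⁻¹' B ∩ {ω : Omega | σ ω ≤ ρ ω}) ∪ {ω : Omega | σ ω ≤ ρ ω}ᶜ := by
      ext ω
      by_cases hω : σ ω ≤ ρ ω <;> simp [Set.indicator, hω, h0]
    rw [this]
    exact key.union hS.compl
  · have : {ω : Omega | σ ω ≤ ρ ω}.indicator h ⁻¹' B =
      (h ⁻¹' B ∩ {ω : Omega | σ ω ≤ ρ ω}) := by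
      ext ω
      by_cases hω : σ ω ≤ ρ ω <;> simp [Set.indicator, hω, h0]
    rw [this]
    exact key

lemma meas_clip {τ : Omega → ℝ≥0∞} (hτ : IsStopping τ) (t : ℝ≥0) :
    Measurable[F t] (clip τ t) := by
  let _ := F t
  refine measurable_of_Iic fun s => ?_
  by_cases h : t ≤ s
  · have : clip τ t ⁻¹' Set.Iic s = Set.univ := by
      ext ω
      simp only [Set.mem_preimage, Set.mem_Iic, Set.mem_univ, iff_true, clip]
      refine le_trans ?_ h
      exact ENNReal.toNNReal_mono (by simp) (min_le_right _ _)
    rw [this]; exact MeasurableSet.univ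
  · have : clip τ t ⁻¹' Set.Iic s = {ω | τ ω ≤ s} := by
      ext ω
      simp only [Set.mem_preimage, Set.mem_Iic, clip, Set.mem_ofPred_eq]
      have hne : min (τ ω) (t : ℝ≥0∞) ≠ ⊤ := by simp
      rw [← ENNReal.coe_le_coe, ENNReal.coe_toNNReal hne, min_le_iff]
      simp [h]
    rw [this]; exact hτ.le_of_le (not_le.1 h).le

lemma clip_le (τ : Omega → ℝ≥0∞) (t : ℝ≥0) (ω : Omega) : clip τ t ω ≤ t :=
  ENNReal.toNNReal_mono (b := (t : ℝ≥0∞)) (by simp) (min_le_right _ _)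

lemma coe_clip (τ : Omega → ℝ≥0∞) (t : ℝ≥0) (ω : Omega) :
    (clip τ t ω : ℝ≥0∞) = min (τ ω) t := ENNReal.coe_toNNReal (by simp)

lemma clip_of_ge {τ : Omega → ℝ≥0∞} {t : ℝ≥0} {ω : Omega} (h : (t : ℝ≥0∞) ≤ τ ω) :
    clip τ t ω = t := by
  simp [clip, min_eq_right h]

lemma cont_clip (τ : Omega → ℝ≥0∞) (ω : Omega) : Continuous (fun t => clip τ t ω) := by
  by_cases h : τ ω = ⊤
  · have : (fun t => clip τ t ω) = id := by
      ext t; simp [clip, h]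
    rw [this]; exact continuous_id
  · have : (fun t => clip τ t ω) = fun t => min (τ ω).toNNReal t := by
      ext t
      rw [NNReal.coe_inj, ← ENNReal.coe_inj, coe_clip]
      simp [ENNReal.coe_toNNReal h]
    rw [this]
    fun_prop

lemma meas_eval_clip {τ : Omega → ℝ≥0∞} (hτ : IsStopping τ) (t : ℝ≥0) :
    Measurable[F t] (fun ω : Omega => ω.1 (clip τ t ω)) := by
  let _ := F t
  have h1 : Measurable (Function.uncurry (fun (s : ℝ≥0) (ω : Omega) => ω.1 (min s t))) := by
    apply measurable_uncurry_of_continuous_of_measurable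
    · intro ω
      exact ω.2.comp (by fun_prop)
    · intro s
      exact meas_eval (min_le_right _ _)
  have h2 : Measurable (fun ω : Omega => (clip τ t ω, ω)) := (meas_clip hτ t).prodMk measurable_id
  have h3 := h1.comp h2
  convert h3 using 1
  ext ω
  simp [Function.uncurry, min_eq_left (clip_le τ t ω)]

/-- A locally finite (unordered) family of trades: trade `k` holds `Δ k` units
between `α k` and `β k`. -/
structure Dat where
  α : ℕ → Omega → ℝ≥0∞
  β : ℕ → Omega → ℝ≥0∞
  Δ : ℕ → Omega → ℝ
  ha : ∀ k, IsStopping (α k)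
  hb : ∀ k, IsStopping (β k)
  hab : ∀ k ω, α k ω ≤ β k ω
  hfin : ∀ ω, ∀ T : ℝ≥0, {k | α k ω ≤ T}.Finite
  hbdd : ∀ k, ∃ C : ℝ, ∀ ω, |Δ k ω| ≤ C
  hmeas : ∀ k, MeasurableAtTime (α k) (Δ k)

namespace Dat

/-- One trade. -/
noncomputable def term (D : Dat) (t : ℝ≥0) (ω : Omega) (k : ℕ) : ℝ :=
  D.Δ k ω * (ω.1 (clip (D.β k) t ω) - ω.1 (clip (D.α k) t ω))

/-- The total gain. -/
noncomputable def cap (D : Dat) (t : ℝ≥0) (ω : Omega) : ℝ := ∑' k, D.term t ω k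

lemma term_zero (D : Dat) {t : ℝ≥0} {ω : Omega} {k : ℕ} (h : (t : ℝ≥0∞) ≤ D.α k ω) :
    D.term t ω k = 0 := by
  unfold term
  rw [clip_of_ge h, clip_of_ge (h.trans (D.hab k ω))]
  simp

lemma exists_bound (D : Dat) (ω : Omega) (T : ℝ≥0) : ∃ M, ∀ k, M ≤ k → (T : ℝ≥0∞) < D.α k ω := by
  obtain ⟨M, hM⟩ := (D.hfin ω T).bddAbove
  refine ⟨M + 1, fun k hk => ?_⟩
  by_contra hcon
  have : k ≤ M := hM (by simpa using hcon)
  omega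

lemma cap_eq_sum (D : Dat) {ω : Omega} {T : ℝ≥0} {M : ℕ}
    (hM : ∀ k, M ≤ k → (T : ℝ≥0∞) < D.α k ω) {t : ℝ≥0} (ht : t ≤ T) :
    D.cap t ω = ∑ k ∈ Finset.range M, D.term t ω k := by
  unfold cap
  apply tsum_eq_sum
  intro k hk
  apply D.term_zero
  have : M ≤ k := by simpa using hk
  exact le_trans (by exact_mod_cast ht) (hM k this).le

lemma summable (D : Dat) (t : ℝ≥0) (ω : Omega) : Summable (D.term t ω) := by
  obtain ⟨M, hM⟩ := D.exists_bound ω t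
  apply summable_of_ne_finset_zero (s := Finset.range M)
  intro k hk
  apply D.term_zero
  exact (hM k (by simpa using hk)).le

lemma cont (D : Dat) (ω : Omega) : Continuous (fun t => D.cap t ω) := by
  rw [continuous_iff_continuousAt]
  intro t
  obtain ⟨M, hM⟩ := D.exists_bound ω (t + 1)
  have h1 : Continuous (fun t => ∑ k ∈ Finset.range M, D.term t ω k) := by
    refine continuous_finsetSum _ fun k _ => ?_
    unfold term
    exact continuous_const.mul
      ((ω.2.comp (cont_clip _ ω)).sub (ω.2.comp (cont_clip _ ω)))
  refine h1.continuousAt.congr ?_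
  have : Set.Iio (t + 1) ∈ 𝓝 t := Iio_mem_nhds (by simp)
  filter_upwards [this] with s hs
  exact (D.cap_eq_sum hM (le_of_lt hs)).symm

lemma meas_term (D : Dat) (t : ℝ≥0) (k : ℕ) : Measurable[F t] (fun ω => D.term t ω k) := by
  have e : (fun ω => D.term t ω k) = fun ω => ({ω : Omega | D.α k ω ≤ t}.indicator (D.Δ k)) ω *
      (ω.1 (clip (D.β k) t ω) - ω.1 (clip (D.α k) t ω)) := by
    ext ω
    by_cases h : D.α k ω ≤ t
    · simp [term, Set.indicator, h]
    · rw [D.term_zero (le_of_not_ge h)]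
      simp [Set.indicator, h]
  rw [e]
  have h1 : Measurable[F t] ({ω : Omega | D.α k ω ≤ t}.indicator (D.Δ k)) := by
    intro B hB
    have key := D.hmeas k B hB t
    have hS := D.ha k t
    let _ := F t
    by_cases h0 : (0 : ℝ) ∈ B
    · have : {ω : Omega | D.α k ω ≤ t}.indicator (D.Δ k) ⁻¹' B =
        (D.Δ k ⁻¹' B ∩ {ω : Omega | D.α k ω ≤ t}) ∪ {ω : Omega | D.α k ω ≤ t}ᶜ := by
        ext ω
        by_cases hω : D.α k ω ≤ t <;> simp [Set.indicator, hω, h0]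
      rw [this]
      exact key.union hS.compl
    · have : {ω : Omega | D.α k ω ≤ t}.indicator (D.Δ k) ⁻¹' B =
        (D.Δ k ⁻¹' B ∩ {ω : Omega | D.α k ω ≤ t}) := by
        ext ω
        by_cases hω : D.α k ω ≤ t <;> simp [Set.indicator, hω, h0]
      rw [this]
      exact key
  have h2 := meas_eval_clip (D.ha k) t
  have h3 := meas_eval_clip (D.hb k) t
  let _ := F t
  exact h1.mul (h3.sub h2)

lemma meas (D : Dat) (t : ℝ≥0) : Measurable[F t] (D.cap t) := by
  have h := D.meas_term t
  let _ := F t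
  refine measurable_of_tendsto_metrizable
    (f := fun n ω => ∑ k ∈ Finset.range n, D.term t ω k) (fun n => ?_) ?_
  · exact Finset.measurable_sum _ fun k _ => h k
  · rw [tendsto_pi_nhds]
    intro ω
    exact (D.summable t ω).hasSum.tendsto_sum_nat

lemma cap_zero (D : Dat) (ω : Omega) : D.cap 0 ω = 0 := by
  unfold cap
  have : ∀ k, D.term 0 ω k = 0 := fun k => D.term_zero (by simp)
  simp [this]

/-- The empty family. -/
def zero : Dat where
  α := fun _ _ => ⊤
  β := fun _ _ => ⊤
  Δ := fun _ _ => 0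
  ha := fun _ => stopping_top
  hb := fun _ => stopping_top
  hab := fun _ _ => le_rfl
  hfin := by intro ω T; simp
  hbdd := fun _ => ⟨0, by simp⟩
  hmeas := by intro k; rw [measAt_iff stopping_top]; exact measurable_const

lemma zero_cap (t : ℝ≥0) (ω : Omega) : zero.cap t ω = 0 := by
  simp [cap, term, zero]

/-- The family of an elementary strategy. -/
def ofElem (G : ElemStrategy) : Dat where
  α := G.τ
  β := fun n => G.τ (n + 1)
  Δ := G.h
  ha := G.stopping
  hb := fun n => G.stopping (n + 1)
  hab := G.mono
  hfin := by
    intro ω T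
    have := ENNReal.tendsto_nhds_top_iff_nnreal.1 (G.tendsto_top ω) T
    rw [← Nat.cofinite_eq_atTop] at this
    simpa [Filter.eventually_cofinite] using this
  hbdd := G.h_bdd
  hmeas := G.h_meas

lemma ofElem_cap (G : ElemStrategy) (c : ℝ) (t : ℝ≥0) (ω : Omega) :
    elemCapital G c t ω = c + (ofElem G).cap t ω := rfl

/-- Scaling. -/
def smul (r : ℝ) (D : Dat) : Dat where
  α := D.α
  β := D.β
  Δ := fun k ω => r * D.Δ k ω
  ha := D.ha
  hb := D.hb
  hab := D.hab
  hfin := D.hfin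
  hbdd := by
    intro k
    obtain ⟨C, hC⟩ := D.hbdd k
    refine ⟨|r| * C, fun ω => ?_⟩
    rw [abs_mul]
    exact mul_le_mul_of_nonneg_left (hC ω) (abs_nonneg _)
  hmeas := by
    intro k
    have := (measAt_iff (D.ha k)).1 (D.hmeas k)
    rw [measAt_iff (D.ha k)]
    exact this.const_mul r

lemma smul_cap (r : ℝ) (D : Dat) (t : ℝ≥0) (ω : Omega) : (smul r D).cap t ω = r * D.cap t ω := by
  unfold cap
  rw [← tsum_mul_left]
  congr 1
  ext k
  simp [term, smul, mul_assoc]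

/-- Stopping. -/
noncomputable def freeze (D : Dat) (ρ : Omega → ℝ≥0∞) (hρ : IsStopping ρ) : Dat where
  α := D.α
  β := fun k ω => max (D.α k ω) (min (D.β k ω) (ρ ω))
  Δ := D.Δ
  ha := D.ha
  hb := fun k => stopping_max (D.ha k) (stopping_min (D.hb k) hρ)
  hab := fun _ _ => le_max_left _ _
  hfin := D.hfin
  hbdd := D.hbdd
  hmeas := D.hmeas

lemma freeze_cap (D : Dat) (ρ : Omega → ℝ≥0∞) (hρ : IsStopping ρ) (t : ℝ≥0) (ω : Omega) :
    (D.freeze ρ hρ).cap t ω = D.cap (clip ρ t ω) ω := by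
  unfold cap
  congr 1
  ext k
  simp only [term, freeze]
  have hab := D.hab k ω
  rcases le_or_gt (ρ ω) (D.α k ω) with h | h
  · have e1 : clip (fun ω => max (D.α k ω) (min (D.β k ω) (ρ ω))) t ω = clip (D.α k) t ω := by
      rw [← ENNReal.coe_inj, coe_clip, coe_clip, max_eq_left (le_trans (min_le_right _ _) h)]
    have e2 : clip (D.β k) (clip ρ t ω) ω = clip (D.α k) (clip ρ t ω) ω := by
      have h3 : (clip ρ t ω : ℝ≥0∞) ≤ D.α k ω := by
        rw [coe_clip]; exact (min_le_left _ _).trans h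
      rw [clip_of_ge h3, clip_of_ge (h3.trans hab)]
    rw [e1, e2]; simp
  · have e1 : clip (fun ω => max (D.α k ω) (min (D.β k ω) (ρ ω))) t ω
        = clip (D.β k) (clip ρ t ω) ω := by
      rw [← ENNReal.coe_inj, coe_clip, coe_clip, coe_clip, max_eq_right (le_min hab h.le),
        min_assoc]
    have e2 : clip (D.α k) (clip ρ t ω) ω = clip (D.α k) t ω := by
      rw [← ENNReal.coe_inj, coe_clip, coe_clip, coe_clip, ← min_assoc, min_eq_left h.le]
    rw [e1, e2]

/-- Sum of two families, by interleaving. -/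
def add (D D' : Dat) : Dat where
  α := fun k => if k % 2 = 0 then D.α (k / 2) else D'.α (k / 2)
  β := fun k => if k % 2 = 0 then D.β (k / 2) else D'.β (k / 2)
  Δ := fun k => if k % 2 = 0 then D.Δ (k / 2) else D'.Δ (k / 2)
  ha := by
    intro k
    split_ifs
    · exact D.ha _
    · exact D'.ha _
  hb := by
    intro k
    split_ifs
    · exact D.hb _
    · exact D'.hb _
  hab := by
    intro k ω
    split_ifs
    · exact D.hab _ _
    · exact D'.hab _ _
  hfin := by
    intro ω T
    obtain ⟨M, hM⟩ := D.exists_bound ω T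
    obtain ⟨M', hM'⟩ := D'.exists_bound ω T
    refine (Set.finite_Iio (2 * M + 2 * M')).subset ?_
    intro k hk
    simp only [Set.mem_ofPred_eq] at hk
    rw [Set.mem_Iio]
    by_contra hcon
    split_ifs at hk
    · exact absurd hk (not_le.2 (hM _ (by omega)))
    · exact absurd hk (not_le.2 (hM' _ (by omega)))
  hbdd := by
    intro k
    split_ifs
    · exact D.hbdd _
    · exact D'.hbdd _
  hmeas := by
    intro k
    split_ifs
    · exact D.hmeas _
    · exact D'.hmeas _

lemma add_cap (D D' : Dat) (t : ℝ≥0) (ω : Omega) :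
    (add D D').cap t ω = D.cap t ω + D'.cap t ω := by
  have h0 : ∀ k, (add D D').term t ω (2 * k) = D.term t ω k := by
    intro k
    simp [term, add]
  have h1 : ∀ k, (add D D').term t ω (2 * k + 1) = D'.term t ω k := by
    intro k
    have e1 : (2 * k + 1) % 2 = 1 := by omega
    have e2 : (2 * k + 1) / 2 = k := by omega
    simp [term, add, e1, e2]
  unfold cap
  rw [← tsum_even_add_odd (f := (add D D').term t ω)]
  · simp only [h0, h1]
  · simp only [h0]; exact D.summable t ω
  · simp only [h1]; exact D'.summable t ω

end Dat

namespace Dat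

/-- Infimum of the starting times with index beyond `n`. -/
noncomputable def tailInf (D : Dat) (n : ℕ) (ω : Omega) : ℝ≥0∞ := ⨅ k : ℕ, D.α (n + 1 + k) ω

lemma tailInf_le (D : Dat) {n k : ℕ} (h : n < k) (ω : Omega) : D.tailInf n ω ≤ D.α k ω := by
  obtain ⟨j, rfl⟩ := Nat.exists_eq_add_of_lt h
  have := iInf_le (fun k : ℕ => D.α (n + 1 + k) ω) j
  have e : n + j + 1 = n + 1 + j := by ring
  rw [e]; exact this

lemma lt_tailInf (D : Dat) {n : ℕ} {ω : Omega} {t : ℝ≥0}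
    (h : ∀ k, n < k → (t : ℝ≥0∞) < D.α k ω) : (t : ℝ≥0∞) < D.tailInf n ω := by
  obtain ⟨M, hM⟩ := D.exists_bound ω (t + 1)
  have h1 : (t : ℝ≥0∞) < min ((t + 1 : ℝ≥0) : ℝ≥0∞)
      ((Finset.range M).inf (fun k => D.α (n + 1 + k) ω)) := by
    refine lt_min ?_ ?_
    · exact_mod_cast (by simp : t < t + 1)
    · rw [Finset.lt_inf_iff (by simp)]
      intro k _
      exact h _ (by omega)
  refine h1.trans_le ?_
  refine le_iInf fun k => ?_
  by_cases hk : k < M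
  · exact (min_le_right _ _).trans (Finset.inf_le (f := fun k => D.α (n + 1 + k) ω)
      (Finset.mem_range.2 hk))
  · exact (min_le_left _ _).trans (hM _ (by omega)).le

lemma stopping_tailInf (D : Dat) (n : ℕ) : IsStopping (D.tailInf n) := by
  intro t
  have : {ω : Omega | D.tailInf n ω ≤ t} = ⋃ k : ℕ, {ω : Omega | D.α (n + 1 + k) ω ≤ t} := by
    ext ω
    simp only [Set.mem_ofPred_eq, Set.mem_iUnion]
    constructor
    · intro h
      by_contra hcon
      push Not at hcon
      refine absurd h (not_le.2 (D.lt_tailInf fun k hk => ?_))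
      have := hcon (k - (n + 1))
      rwa [show n + 1 + (k - (n + 1)) = k by omega] at this
    · rintro ⟨k, hk⟩
      exact (D.tailInf_le (by omega) ω).trans hk
  rw [this]
  exact @MeasurableSet.iUnion _ _ (F t) _ _ fun k => D.ha _ t

open Classical in
/-- The first of the times `α k, β k`, `k ≤ n`, strictly after `ρ`. -/
noncomputable def nx (D : Dat) (n : ℕ) (ρ : Omega → ℝ≥0∞) (ω : Omega) : ℝ≥0∞ :=
  (Finset.range (n + 1)).inf fun k =>
    min (if ρ ω < D.α k ω then D.α k ω else ⊤) (if ρ ω < D.β k ω then D.β k ω else ⊤)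

lemma stopping_nx (D : Dat) (n : ℕ) {ρ : Omega → ℝ≥0∞} (hρ : IsStopping ρ) :
    IsStopping (D.nx n ρ) := by
  classical
  intro t
  have : {ω : Omega | D.nx n ρ ω ≤ t} = ⋃ k ∈ Finset.range (n + 1), {ω : Omega |
      min (if ρ ω < D.α k ω then D.α k ω else ⊤) (if ρ ω < D.β k ω then D.β k ω else ⊤) ≤ t} := by
    ext ω
    simp only [Set.mem_ofPred_eq, Set.mem_iUnion, nx]
    rw [Finset.inf_le_iff (by simp)]
    simp only [exists_prop]
  rw [this]
  refine @Finset.measurableSet_biUnion _ _ (F t) _ _ fun k _ => ?_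
  convert stopping_min (stopping_next hρ (D.ha k)) (stopping_next hρ (D.hb k)) t

lemma nx_le_a (D : Dat) {n k : ℕ} (hk : k ≤ n) {ρ : Omega → ℝ≥0∞} {ω : Omega}
    (h : ρ ω < D.α k ω) : D.nx n ρ ω ≤ D.α k ω := by
  classical
  unfold nx
  refine (Finset.inf_le (Finset.mem_range.2 (Nat.lt_succ_of_le hk))).trans ?_
  simp [h]

lemma nx_le_b (D : Dat) {n k : ℕ} (hk : k ≤ n) {ρ : Omega → ℝ≥0∞} {ω : Omega}
    (h : ρ ω < D.β k ω) : D.nx n ρ ω ≤ D.β k ω := by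
  classical
  unfold nx
  refine (Finset.inf_le (Finset.mem_range.2 (Nat.lt_succ_of_le hk))).trans ?_
  simp [h]

lemma nx_cases (D : Dat) (n : ℕ) (ρ : Omega → ℝ≥0∞) (ω : Omega) {t : ℝ≥0}
    (h : D.nx n ρ ω ≤ t) :
    ∃ k, k ≤ n ∧ ρ ω < D.nx n ρ ω ∧ (D.nx n ρ ω = D.α k ω ∨ D.nx n ρ ω = D.β k ω) := by
  classical
  obtain ⟨k, hk, e⟩ := Finset.exists_mem_eq_inf (Finset.range (n + 1)) (by simp) (fun k =>
    min (if ρ ω < D.α k ω then D.α k ω else ⊤) (if ρ ω < D.β k ω then D.β k ω else ⊤))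
  have e' : D.nx n ρ ω = min (if ρ ω < D.α k ω then D.α k ω else ⊤)
    (if ρ ω < D.β k ω then D.β k ω else ⊤) := e
  refine ⟨k, by simpa [Nat.lt_succ_iff] using hk, ?_⟩
  have hlt : D.nx n ρ ω < ⊤ := h.trans_lt (by simp)
  rw [e'] at hlt ⊢
  rcases min_choice (if ρ ω < D.α k ω then D.α k ω else ⊤)
    (if ρ ω < D.β k ω then D.β k ω else ⊤) with h2 | h2
  · rw [h2] at hlt ⊢
    split_ifs at hlt ⊢ with h3
    · exact ⟨h3, Or.inl rfl⟩
    · simp at hlt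
  · rw [h2] at hlt ⊢
    split_ifs at hlt ⊢ with h3
    · exact ⟨h3, Or.inr rfl⟩
    · simp at hlt

/-- The sorted sequence of times. -/
noncomputable def rho (D : Dat) : ℕ → Omega → ℝ≥0∞
  | 0 => fun _ => 0
  | n + 1 => fun ω => max (rho D n ω) (min (D.tailInf n ω) (D.nx n (rho D n) ω))

lemma stopping_rho (D : Dat) (n : ℕ) : IsStopping (D.rho n) := by
  induction n with
  | zero => exact stopping_zero
  | succ n ih => exact stopping_max ih (stopping_min (D.stopping_tailInf n) (D.stopping_nx n ih))

lemma rho_mono (D : Dat) (n : ℕ) (ω : Omega) : D.rho n ω ≤ D.rho (n + 1) ω :=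
  le_max_left _ _

lemma rho_succ (D : Dat) {n : ℕ} {ω : Omega} (h : D.rho n ω < D.rho (n + 1) ω) :
    D.rho (n + 1) ω = min (D.tailInf n ω) (D.nx n (D.rho n) ω) := by
  change D.rho n ω < max _ _ at h
  change max _ _ = _
  rcases lt_max_iff.1 h with h | h
  · exact absurd h (lt_irrefl _)
  · exact max_eq_right h.le

lemma rho_key_a (D : Dat) {n k : ℕ} {ω : Omega} (h : D.rho n ω < D.rho (n + 1) ω)
    (hk : D.α k ω < D.rho (n + 1) ω) : k ≤ n ∧ D.α k ω ≤ D.rho n ω := by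
  rw [D.rho_succ h] at hk
  have h1 : k ≤ n := by
    by_contra hcon
    exact absurd (hk.trans_le (min_le_left _ _)) (not_lt.2 (D.tailInf_le (not_le.1 hcon) ω))
  refine ⟨h1, ?_⟩
  by_contra hcon
  exact absurd (hk.trans_le (min_le_right _ _)) (not_lt.2 (D.nx_le_a h1 (not_le.1 hcon)))

lemma rho_key_b (D : Dat) {n k : ℕ} {ω : Omega} (h : D.rho n ω < D.rho (n + 1) ω)
    (hk : D.β k ω < D.rho (n + 1) ω) : D.β k ω ≤ D.rho n ω := by
  have h1 := (D.rho_key_a h ((D.hab k ω).trans_lt hk)).1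
  rw [D.rho_succ h] at hk
  by_contra hcon
  exact absurd (hk.trans_le (min_le_right _ _)) (not_lt.2 (D.nx_le_b h1 (not_le.1 hcon)))

lemma rho_unbdd (D : Dat) (ω : Omega) (T : ℝ≥0) : ∃ n, (T : ℝ≥0∞) < D.rho n ω := by
  by_contra hcon
  push Not at hcon
  obtain ⟨M, hM⟩ := D.exists_bound ω T
  have step : ∀ n, M ≤ n → D.rho n ω < D.rho (n + 1) ω ∧
      ∃ k, k < M ∧ (D.rho (n + 1) ω = D.α k ω ∨ D.rho (n + 1) ω = D.β k ω) := by
    intro n hn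
    have hm : (T : ℝ≥0∞) < D.tailInf n ω := D.lt_tailInf fun k hk => hM k (by omega)
    have hle : min (D.tailInf n ω) (D.nx n (D.rho n) ω) ≤ T :=
      (le_max_right _ _).trans (hcon (n + 1))
    have hnx : D.nx n (D.rho n) ω ≤ T := by
      rcases min_le_iff.1 hle with h | h
      · exact absurd h (not_le.2 hm)
      · exact h
    obtain ⟨k, hk, h1, h2⟩ := D.nx_cases n (D.rho n) ω hnx
    have hmin : min (D.tailInf n ω) (D.nx n (D.rho n) ω) = D.nx n (D.rho n) ω :=
      min_eq_right (hnx.trans hm.le)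
    have e : D.rho (n + 1) ω = D.nx n (D.rho n) ω := by
      change max _ _ = _
      rw [hmin]
      exact max_eq_right h1.le
    rw [e]
    refine ⟨h1, k, ?_, h2⟩
    by_contra hk'
    have := hM k (not_lt.1 hk')
    have h3 : D.α k ω ≤ T := by
      rcases h2 with h2 | h2
      · rw [← h2]; exact hnx
      · exact (D.hab k ω).trans (by rw [← h2]; exact hnx)
    exact absurd h3 (not_le.2 this)
  have hsm : StrictMono (fun n => D.rho (M + n + 1) ω) :=
    strictMono_nat_of_lt_succ fun n => (step (M + n + 1) (by omega)).1
  have hfin : ((fun k => D.α k ω) '' Set.Iio M ∪ (fun k => D.β k ω) '' Set.Iio M).Finite :=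
    ((Set.finite_Iio M).image _).union ((Set.finite_Iio M).image _)
  refine Set.infinite_of_injective_forall_mem hsm.injective ?_ hfin
  intro n
  obtain ⟨-, k, hk, h | h⟩ := step (M + n) (by omega)
  · exact Or.inl ⟨k, hk, h.symm⟩
  · exact Or.inr ⟨k, hk, h.symm⟩

lemma rho_tendsto (D : Dat) (ω : Omega) : Tendsto (fun n => D.rho n ω) atTop (𝓝 ⊤) := by
  rw [ENNReal.tendsto_nhds_top_iff_nnreal]
  intro T
  obtain ⟨n, hn⟩ := D.rho_unbdd ω T
  filter_upwards [eventually_ge_atTop n] with m hm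
  exact hn.trans_le (monotone_nat_of_le_succ (fun n => D.rho_mono n ω) hm)

open Classical in
/-- The total holding right after the `n`-th time. -/
noncomputable def hold (D : Dat) (n : ℕ) (ω : Omega) : ℝ :=
  ∑ k ∈ Finset.range (n + 1),
    {ω : Omega | D.rho n ω < D.β k ω}.indicator
      ({ω : Omega | D.α k ω ≤ D.rho n ω}.indicator (D.Δ k)) ω

/-- The elementary strategy of a family. -/
noncomputable def toElem (D : Dat) : ElemStrategy where
  τ := D.rho
  stopping := D.stopping_rho
  mono := D.rho_mono
  tendsto_top := D.rho_tendsto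
  h := D.hold
  h_bdd := by
    intro n
    choose C hC using D.hbdd
    refine ⟨∑ k ∈ Finset.range (n + 1), C k, fun ω => ?_⟩
    refine (Finset.abs_sum_le_sum_abs _ _).trans (Finset.sum_le_sum fun k _ => ?_)
    have h0 : 0 ≤ C k := (abs_nonneg _).trans (hC k ω)
    unfold Set.indicator
    split_ifs
    · exact hC k ω
    · simpa using h0
    · simpa using h0
  h_meas := by
    intro n
    rw [measAt_iff (D.stopping_rho n)]
    have h1 := fun k => meas_indicator (D.stopping_rho n) (D.ha k) (D.hmeas k)
    have h2 := fun k => meas_lt (D.stopping_rho n) (D.hb k)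
    let _ := Fst _ (D.stopping_rho n)
    refine Finset.measurable_sum _ fun k _ => ?_
    exact (h1 k).indicator (h2 k)

/-- Value of the path at time `s` clamped to `[α, β]` and then to `[0, t]`. -/
noncomputable def phi (D : Dat) (t : ℝ≥0) (ω : Omega) (k : ℕ) (s : ℝ≥0∞) : ℝ :=
  ω.1 ((min (max (D.α k ω) (min s (D.β k ω))) (t : ℝ≥0∞)).toNNReal)

lemma phi_zero (D : Dat) (t : ℝ≥0) (ω : Omega) (k : ℕ) :
    D.phi t ω k 0 = ω.1 (clip (D.α k) t ω) := by
  simp [phi, clip]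

lemma phi_large (D : Dat) (t : ℝ≥0) (ω : Omega) (k : ℕ) {s : ℝ≥0∞} (hs : t ≤ s) :
    D.phi t ω k s = ω.1 (clip (D.β k) t ω) := by
  unfold phi clip
  have hab := D.hab k ω
  rcases le_total s (D.β k ω) with h | h
  · rw [min_eq_left h, min_eq_right (hs.trans (le_max_right _ _)), min_eq_right (hs.trans h)]
  · rw [min_eq_right h, max_eq_right hab]

lemma piece (D : Dat) (t : ℝ≥0) (ω : Omega) (n k : ℕ) :
    (if k ≤ n then {ω : Omega | D.rho n ω < D.β k ω}.indicator
      ({ω : Omega | D.α k ω ≤ D.rho n ω}.indicator (D.Δ k)) ω else 0) *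
      (ω.1 (clip (D.rho (n + 1)) t ω) - ω.1 (clip (D.rho n) t ω)) =
    D.Δ k ω * (D.phi t ω k (D.rho (n + 1) ω) - D.phi t ω k (D.rho n ω)) := by
  classical
  rcases (D.rho_mono n ω).eq_or_lt with h | h
  · have : clip (D.rho (n + 1)) t ω = clip (D.rho n) t ω := by
      simp [clip, h]
    rw [this, h]; simp
  · have hab := D.hab k ω
    rcases le_or_gt (D.rho (n + 1) ω) (D.α k ω) with h1 | h1
    · have h2 : ¬ D.α k ω ≤ D.rho n ω := not_le.2 (h.trans_le h1)
      have e1 : max (D.α k ω) (min (D.rho (n + 1) ω) (D.β k ω)) = D.α k ω :=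
        max_eq_left ((min_le_left _ _).trans h1)
      have e2 : max (D.α k ω) (min (D.rho n ω) (D.β k ω)) = D.α k ω :=
        max_eq_left ((min_le_left _ _).trans (h.le.trans h1))
      simp [Set.indicator, h2, phi, e1, e2]
    · obtain ⟨hk, h2⟩ := D.rho_key_a h h1
      rcases le_or_gt (D.β k ω) (D.rho n ω) with h3 | h3
      · have e1 : min (D.rho (n + 1) ω) (D.β k ω) = D.β k ω := min_eq_right (h3.trans h.le)
        have e2 : min (D.rho n ω) (D.β k ω) = D.β k ω := min_eq_right h3
        simp [Set.indicator, not_lt.2 h3, phi, e1, e2]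
      · have h4 : D.rho (n + 1) ω ≤ D.β k ω := by
          by_contra hcon
          exact absurd (D.rho_key_b h (not_le.1 hcon)) (not_le.2 h3)
        have e1 : max (D.α k ω) (min (D.rho (n + 1) ω) (D.β k ω)) = D.rho (n + 1) ω := by
          rw [min_eq_left h4, max_eq_right h1.le]
        have e2 : max (D.α k ω) (min (D.rho n ω) (D.β k ω)) = D.rho n ω := by
          rw [min_eq_left h3.le, max_eq_right h2]
        simp [Set.indicator, h3, h2, hk, phi, e1, e2, clip]

lemma toElem_cap (D : Dat) (c : ℝ) (t : ℝ≥0) (ω : Omega) :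
    elemCapital D.toElem c t ω = c + D.cap t ω := by
  unfold elemCapital
  congr 1
  obtain ⟨M, hM⟩ := D.exists_bound ω t
  obtain ⟨N, hN⟩ := D.rho_unbdd ω t
  have hN' : ∀ n, N ≤ n → (t : ℝ≥0∞) ≤ D.rho n ω := fun n hn =>
    hN.le.trans (monotone_nat_of_le_succ (fun n => D.rho_mono n ω) hn)
  have e1 : (∑' n : ℕ, D.toElem.h n ω *
      (ω.1 (clip (D.toElem.τ (n + 1)) t ω) - ω.1 (clip (D.toElem.τ n) t ω))) =
      ∑ n ∈ Finset.range N, D.toElem.h n ω *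
      (ω.1 (clip (D.toElem.τ (n + 1)) t ω) - ω.1 (clip (D.toElem.τ n) t ω)) := by
    apply tsum_eq_sum
    intro n hn
    have hn' : N ≤ n := by simpa using hn
    have a1 : clip (D.toElem.τ (n + 1)) t ω = t := clip_of_ge (hN' (n + 1) (by omega))
    have a2 : clip (D.toElem.τ n) t ω = t := clip_of_ge (hN' n hn')
    rw [a1, a2]; simp
  rw [e1]
  set L := max M (N + 1) with hL
  have hML : ∀ k, L ≤ k → (t : ℝ≥0∞) < D.α k ω := fun k hk =>
    hM k ((le_max_left _ _).trans hk)
  rw [D.cap_eq_sum hML le_rfl]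
  have e2 : ∀ n ∈ Finset.range N, D.toElem.h n ω *
      (ω.1 (clip (D.toElem.τ (n + 1)) t ω) - ω.1 (clip (D.toElem.τ n) t ω)) =
      ∑ k ∈ Finset.range L,
        D.Δ k ω * (D.phi t ω k (D.rho (n + 1) ω) - D.phi t ω k (D.rho n ω)) := by
    intro n hn
    have hnN : n < N := Finset.mem_range.1 hn
    simp only [← D.piece t ω n]
    rw [← Finset.sum_mul]
    congr 1
    change D.hold n ω = _
    unfold hold
    have hsub : Finset.range (n + 1) ⊆ Finset.range L := by
      apply Finset.range_subset_range.2
      have : N + 1 ≤ L := le_max_right _ _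
      omega
    rw [← Finset.sum_subset hsub]
    · refine Finset.sum_congr rfl fun k hk => ?_
      have : k ≤ n := by have := Finset.mem_range.1 hk; omega
      simp [this]
    · intro k _ hk
      have : ¬ k ≤ n := by
        intro h
        exact hk (Finset.mem_range.2 (by omega))
      simp [this]
  rw [Finset.sum_congr rfl e2, Finset.sum_comm]
  refine Finset.sum_congr rfl fun k _ => ?_
  rw [← Finset.mul_sum, Finset.sum_range_sub (fun n => D.phi t ω k (D.rho n ω))]
  unfold term
  rw [D.phi_large t ω k hN.le]
  change _ * (_ - D.phi t ω k 0) = _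
  rw [phi_zero]

end Dat

/-- First time the process `Y` reaches level `r`. -/
noncomputable def hit (Y : ℝ≥0 → Omega → ℝ) (r : ℝ) (ω : Omega) : ℝ≥0∞ :=
  ⨅ (t : ℝ≥0) (_ : r ≤ Y t ω), (t : ℝ≥0∞)

lemma hit_le {Y : ℝ≥0 → Omega → ℝ} {r : ℝ} {ω : Omega} {t : ℝ≥0} (h : r ≤ Y t ω) :
    hit Y r ω ≤ t := iInf₂_le t h

lemma hit_attained {Y : ℝ≥0 → Omega → ℝ} {r : ℝ} {ω : Omega} (hc : Continuous fun t => Y t ω)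
    {s : ℝ≥0} (hs : hit Y r ω = s) : r ≤ Y s ω := by
  have hcl : IsClosed {t : ℝ≥0 | r ≤ Y t ω} := isClosed_le continuous_const hc
  by_contra hcon
  have hnb : {t : ℝ≥0 | r ≤ Y t ω}ᶜ ∈ 𝓝 s := hcl.isOpen_compl.mem_nhds hcon
  obtain ⟨u, hu, hsub⟩ := exists_Ico_subset_of_mem_nhds hnb ⟨s + 1, by simp⟩
  have h1 : (u : ℝ≥0∞) ≤ hit Y r ω := by
    refine le_iInf₂ fun t ht => ?_
    by_contra hlt
    have hlt' : t < u := by exact_mod_cast not_le.1 hlt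
    have hst : s ≤ t := by
      have := hit_le ht
      rw [hs] at this
      exact_mod_cast this
    exact hsub ⟨hst, hlt'⟩ ht
  rw [hs] at h1
  exact absurd hu (not_lt.2 (by exact_mod_cast h1))

lemma hit_le_iff {Y : ℝ≥0 → Omega → ℝ} {r : ℝ} {ω : Omega} (hc : Continuous fun t => Y t ω)
    {t : ℝ≥0} : hit Y r ω ≤ t ↔ ∃ s, s ≤ t ∧ r ≤ Y s ω := by
  constructor
  · intro h
    have hne : hit Y r ω ≠ ⊤ := (h.trans_lt (by simp)).ne
    refine ⟨(hit Y r ω).toNNReal, ?_, hit_attained hc (ENNReal.coe_toNNReal hne).symm⟩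
    rw [← ENNReal.coe_le_coe, ENNReal.coe_toNNReal hne]
    exact h
  · rintro ⟨s, hs, h⟩
    exact (hit_le h).trans (by exact_mod_cast hs)

lemma stopping_hit {Y : ℝ≥0 → Omega → ℝ} (r : ℝ) (hc : ∀ ω, Continuous fun t => Y t ω)
    (hm : ∀ t, Measurable[F t] (Y t)) : IsStopping (hit Y r) := by
  intro t
  have : {ω : Omega | hit Y r ω ≤ t} = ⋂ j : ℕ, ⋃ q : ℕ,
      {ω : Omega | r - 1 / ((j : ℝ) + 1) < Y (min (TopologicalSpace.denseSeq ℝ≥0 q) t) ω} := by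
    ext ω
    simp only [Set.mem_ofPred_eq, Set.mem_iInter, Set.mem_iUnion]
    rw [hit_le_iff (hc ω)]
    have hc' : Continuous fun s => Y (min s t) ω := (hc ω).comp (by fun_prop)
    constructor
    · rintro ⟨s, hs, h⟩ j
      have hpos : (0 : ℝ) < 1 / ((j : ℝ) + 1) := by positivity
      have hopen : IsOpen {s | r - 1 / ((j : ℝ) + 1) < Y (min s t) ω} :=
        isOpen_lt continuous_const hc'
      obtain ⟨q, hq⟩ := (TopologicalSpace.denseRange_denseSeq ℝ≥0).exists_mem_open hopen
        ⟨s, by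
          change _ < Y (min s t) ω
          rw [min_eq_left hs]
          linarith⟩
      exact ⟨q, hq⟩
    · intro h
      obtain ⟨s, hs, hmax⟩ := (isCompact_Icc (a := (0 : ℝ≥0)) (b := t)).exists_isMaxOn
        ⟨0, by simp⟩ (hc ω).continuousOn
      refine ⟨s, hs.2, ?_⟩
      by_contra hcon
      obtain ⟨j, hj⟩ := exists_nat_one_div_lt (sub_pos.2 (not_le.1 hcon))
      obtain ⟨q, hq⟩ := h j
      have := hmax (show min (TopologicalSpace.denseSeq ℝ≥0 q) t ∈ Set.Icc 0 t by simp)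
      simp only [Set.mem_ofPred_eq] at this
      linarith
  rw [this]
  have hm' : ∀ q : ℕ, Measurable[F t] (Y (min (TopologicalSpace.denseSeq ℝ≥0 q) t)) :=
    fun q => (hm _).mono (F_mono_s1 (min_le_right _ _)) le_rfl
  let _ := F t
  exact MeasurableSet.iInter fun j => MeasurableSet.iUnion fun q =>
    measurableSet_lt measurable_const (hm' q)

lemma le_of_hit {Y : ℝ≥0 → Omega → ℝ} {r : ℝ} {ω : Omega} (hc : Continuous fun t => Y t ω)
    {u : ℝ≥0} (hu : 0 < u) (h : (u : ℝ≥0∞) ≤ hit Y r ω) : Y u ω ≤ r := by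
  have hlt : ∀ s, s < u → Y s ω < r := by
    intro s hs
    by_contra hcon
    exact absurd (h.trans (hit_le (not_lt.1 hcon))) (not_le.2 (by exact_mod_cast hs))
  have hcl : IsClosed {s : ℝ≥0 | Y s ω ≤ r} := isClosed_le hc continuous_const
  have hsub : closure (Set.Iio u) ⊆ {s : ℝ≥0 | Y s ω ≤ r} :=
    hcl.closure_subset_iff.2 fun s hs => (hlt s hs).le
  rw [closure_Iio' (a := u) ⟨0, Set.mem_Iio.2 hu⟩] at hsub
  exact hsub (Set.mem_Iic.2 le_rfl)

section main

variable (S : PosCapital)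

/-- Partial sums of the gains. -/
noncomputable def psum : ℕ → Dat
  | 0 => Dat.zero
  | n + 1 => Dat.add (psum n) (Dat.ofElem (S.G n))

/-- Partial sums of the capital. -/
noncomputable def pY (n : ℕ) (t : ℝ≥0) (ω : Omega) : ℝ :=
  ∑ k ∈ Finset.range n, S.c k + (psum S n).cap t ω

lemma pY_zero (t : ℝ≥0) (ω : Omega) : pY S 0 t ω = 0 := by
  simp [pY, psum, Dat.zero_cap]

lemma pY_succ (n : ℕ) (t : ℝ≥0) (ω : Omega) :
    pY S (n + 1) t ω = pY S n t ω + elemCapital (S.G n) (S.c n) t ω := by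
  rw [Dat.ofElem_cap]
  simp only [pY, psum, Dat.add_cap, Finset.sum_range_succ]
  ring

lemma pY_eq (n : ℕ) (t : ℝ≥0) (ω : Omega) :
    pY S n t ω = ∑ k ∈ Finset.range n, elemCapital (S.G k) (S.c k) t ω := by
  induction n with
  | zero => simp [pY_zero]
  | succ n ih => rw [pY_succ, ih, Finset.sum_range_succ]

lemma pY_mono (n : ℕ) (t : ℝ≥0) (ω : Omega) : pY S n t ω ≤ pY S (n + 1) t ω := by
  rw [pY_succ]
  linarith [S.nonneg n t ω]

lemma pY_cont (n : ℕ) (ω : Omega) : Continuous fun t => pY S n t ω :=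
  continuous_const.add ((psum S n).cont ω)

lemma pY_meas (n : ℕ) (t : ℝ≥0) : Measurable[F t] (pY S n t) := by
  have h := (psum S n).meas t
  let _ := F t
  exact measurable_const.add h

lemma stopping_pY (θ : ℝ) (n : ℕ) : IsStopping (hit (pY S n) θ) :=
  stopping_hit θ (pY_cont S n) (pY_meas S n)

lemma hit_anti (θ : ℝ) (n : ℕ) (ω : Omega) :
    hit (pY S (n + 1)) θ ω ≤ hit (pY S n) θ ω :=
  le_iInf₂ fun t ht => hit_le (ht.trans (pY_mono S n t ω))

/-- Stopped partial sums. -/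
noncomputable def pT (θ : ℝ) (n : ℕ) (t : ℝ≥0) (ω : Omega) : ℝ :=
  pY S n (clip (hit (pY S n) θ) t ω) ω

lemma pT_mono (θ : ℝ) (n : ℕ) (t : ℝ≥0) (ω : Omega) : pT S θ n t ω ≤ pT S θ (n + 1) t ω := by
  unfold pT
  have hanti := hit_anti S θ n ω
  rcases le_or_gt (t : ℝ≥0∞) (hit (pY S (n + 1)) θ ω) with h | h
  · rw [clip_of_ge h, clip_of_ge (h.trans hanti)]
    exact pY_mono S n t ω
  · rcases hanti.eq_or_lt with e | hlt
    · have : clip (hit (pY S (n + 1)) θ) t ω = clip (hit (pY S n) θ) t ω := by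
        simp [clip, e]
      rw [this]
      exact pY_mono S n _ ω
    · have h1 : θ ≤ pY S (n + 1) (clip (hit (pY S (n + 1)) θ) t ω) ω := by
        apply hit_attained (pY_cont S (n + 1) ω)
        rw [coe_clip, min_eq_left h.le]
      refine le_trans ?_ h1
      apply le_of_hit (pY_cont S n ω)
      · rw [← ENNReal.coe_lt_coe, coe_clip]
        refine lt_min (lt_of_le_of_lt (by simp) hlt) (lt_of_le_of_lt (by simp) h)
      · rw [coe_clip]
        exact min_le_left _ _

/-- Strategy of the differences of the stopped partial sums, scaled. -/
noncomputable def newDat (θ : ℝ) (n : ℕ) : Dat :=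
  Dat.smul θ⁻¹ (Dat.add ((psum S (n + 1)).freeze _ (stopping_pY S θ (n + 1)))
    (Dat.smul (-1) ((psum S n).freeze _ (stopping_pY S θ n))))

lemma newDat_cap (θ : ℝ) (n : ℕ) (t : ℝ≥0) (ω : Omega) :
    elemCapital (newDat S θ n).toElem (θ⁻¹ * S.c n) t ω =
      θ⁻¹ * (pT S θ (n + 1) t ω - pT S θ n t ω) := by
  rw [Dat.toElem_cap]
  simp only [newDat, Dat.smul_cap, Dat.add_cap, Dat.freeze_cap, pT, pY, Finset.sum_range_succ]
  ring

/-- The stopped positive capital process. -/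
noncomputable def newS {θ : ℝ} (hθ : 0 < θ) : PosCapital where
  G := fun n => (newDat S θ n).toElem
  c := fun n => θ⁻¹ * S.c n
  c_pos := fun n => mul_pos (inv_pos.2 hθ) (S.c_pos n)
  c_summable := S.c_summable.mul_left _
  nonneg := by
    intro n t ω
    rw [newDat_cap]
    exact mul_nonneg (inv_pos.2 hθ).le (sub_nonneg.2 (pT_mono S θ n t ω))

lemma newS_init {θ : ℝ} (hθ : 0 < θ) : (newS S hθ).init = ENNReal.ofReal θ⁻¹ * S.init := by
  unfold PosCapital.init
  rw [← ENNReal.tsum_mul_left]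
  congr 1
  ext n
  exact ENNReal.ofReal_mul (inv_pos.2 hθ).le

lemma newS_value {θ : ℝ} (hθ : 0 < θ) (n : ℕ) (t : ℝ≥0) (ω : Omega) :
    ENNReal.ofReal (θ⁻¹ * pT S θ n t ω) ≤ (newS S hθ).value t ω := by
  have h0 : pT S θ 0 t ω = 0 := pY_zero S _ ω
  have e : θ⁻¹ * pT S θ n t ω = ∑ k ∈ Finset.range n,
      elemCapital ((newS S hθ).G k) ((newS S hθ).c k) t ω := by
    have : ∀ k, elemCapital ((newS S hθ).G k) ((newS S hθ).c k) t ω =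
      θ⁻¹ * (pT S θ (k + 1) t ω - pT S θ k t ω) := fun k => newDat_cap S θ k t ω
    simp only [this]
    rw [← Finset.mul_sum, Finset.sum_range_sub (fun n => pT S θ n t ω), h0, sub_zero]
  rw [e, ENNReal.ofReal_sum_of_nonneg fun k _ => (newS S hθ).nonneg k t ω]
  exact ENNReal.sum_le_tsum _

lemma exists_partial {θ : ℝ} {t : ℝ≥0} {ω : Omega}
    (h : ENNReal.ofReal θ < S.value t ω) : ∃ n, θ ≤ pY S n t ω := by
  unfold PosCapital.value at h
  rw [ENNReal.tsum_eq_iSup_nat] at h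
  obtain ⟨n, hn⟩ := lt_iSup_iff.1 h
  refine ⟨n, ?_⟩
  rw [← ENNReal.ofReal_sum_of_nonneg fun k _ => S.nonneg k t ω, ← pY_eq] at hn
  by_contra hcon
  exact absurd hn (not_lt.2 (ENNReal.ofReal_le_ofReal (not_le.1 hcon).le))

lemma newS_liminf {θ : ℝ} (hθ : 0 < θ) (hθ1 : θ < 1) {ω : Omega}
    (h : 1 ≤ ⨆ t : ℝ≥0, S.value t ω) :
    1 ≤ liminf (fun t : ℝ≥0 => (newS S hθ).value t ω) atTop := by
  have h1 : ENNReal.ofReal θ < ⨆ t : ℝ≥0, S.value t ω :=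
    lt_of_lt_of_le (by rw [ENNReal.ofReal_lt_one]; exact hθ1) h
  obtain ⟨t₀, ht₀⟩ := lt_iSup_iff.1 h1
  obtain ⟨n, hn⟩ := exists_partial S ht₀
  refine le_liminf_of_le (by isBoundedDefault) ?_
  filter_upwards [eventually_ge_atTop t₀] with t ht
  refine le_trans ?_ (newS_value S hθ n t ω)
  have h2 : θ ≤ pT S θ n t ω := by
    apply hit_attained (pY_cont S n ω)
    rw [coe_clip, min_eq_left]
    exact (hit_le hn).trans (by exact_mod_cast ht)
  rw [ENNReal.one_le_ofReal]
  calc (1 : ℝ) = θ⁻¹ * θ := (inv_mul_cancel₀ hθ.ne').symm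
    _ ≤ _ := mul_le_mul_of_nonneg_left h2 (inv_pos.2 hθ).le

end main

/-- the two definitions of upper probability, via `liminf_{t→∞}`
and via `sup_{t∈[0,∞)}`, are equivalent. -/
theorem upProb_eq_upProbSup (E : Set Omega) : UpProb E = UpProbSup E := by
  apply le_antisymm
  · refine le_iInf₂ fun S hS => ?_
    have key : ∀ n : ℕ, UpProb E ≤ ENNReal.ofReal (1 + 1 / ((n : ℝ) + 1)) * S.init := by
      intro n
      have hpos : (0 : ℝ) < 1 / ((n : ℝ) + 1) := by positivity
      have hθ : 0 < (1 + 1 / ((n : ℝ) + 1))⁻¹ := by positivity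
      have hθ1 : (1 + 1 / ((n : ℝ) + 1))⁻¹ < 1 := inv_lt_one_of_one_lt₀ (by linarith)
      have h1 := newS_init S hθ
      rw [inv_inv] at h1
      rw [← h1]
      refine iInf₂_le (newS S hθ) fun ω => ?_
      by_cases hω : ω ∈ E
      · have h2 := hS ω
        rw [Set.indicator_of_mem hω] at h2 ⊢
        exact newS_liminf S hθ hθ1 h2
      · rw [Set.indicator_of_notMem hω]
        exact zero_le
    have hfin : S.init ≠ ⊤ := S.c_summable.tsum_ofReal_ne_top
    have ht : Tendsto (fun n : ℕ => ENNReal.ofReal (1 + 1 / ((n : ℝ) + 1)) * S.init) atTop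
        (𝓝 (ENNReal.ofReal (1 + 0) * S.init)) := by
      refine ENNReal.Tendsto.mul_const ?_ (Or.inr hfin)
      exact ENNReal.tendsto_ofReal (tendsto_const_nhds.add tendsto_one_div_add_atTop_nhds_zero_nat)
    have := ge_of_tendsto' ht key
    simpa using this
  · refine le_iInf₂ fun S hS => ?_
    refine iInf₂_le S fun ω => (hS ω).trans ?_
    refine (liminf_le_limsup).trans ?_
    refine limsup_le_of_le (by isBoundedDefault) (Eventually.of_forall fun t => ?_)
    exact le_iSup (fun t : ℝ≥0 => S.value t ω) t

end GTP
end

section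
/- A set E ⊆ Ω is null if and only if there exists a positive capital process S with S_0 = 1 such that lim_{t→∞} S_t(ω) = ∞ for all ω ∈ E. -/
open Filter Topology MeasureTheory
open scoped ENNReal NNReal

namespace GTP

/-- Scaling of an elementary strategy. -/
noncomputable def ElemStrategy.scale (G : ElemStrategy) (a : ℝ) : ElemStrategy where
  τ := G.τ
  stopping := G.stopping
  mono := G.mono
  tendsto_top := G.tendsto_top
  h := fun n ω => a * G.h n ω
  h_bdd := by
    intro n
    obtain ⟨C, hC⟩ := G.h_bdd n
    refine ⟨|a| * C, fun ω => ?_⟩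
    rw [abs_mul]
    exact mul_le_mul_of_nonneg_left (hC ω) (abs_nonneg a)
  h_meas := by
    intro n B hB t
    have hm : Measurable (fun x : ℝ => a * x) := measurable_const_mul a
    exact G.h_meas n _ (hm hB) t

theorem elemCapital_scale (G : ElemStrategy) (a c : ℝ) (t : ℝ≥0) (ω : Omega) :
    elemCapital (G.scale a) (a * c) t ω = a * elemCapital G c t ω := by
  unfold elemCapital
  rw [mul_add, ← tsum_mul_left]
  simp only [ElemStrategy.scale, mul_assoc]

/-- Scaling of a positive capital process by a positive constant. -/
noncomputable def PosCapital.scale (S : PosCapital) (a : ℝ) (ha : 0 < a) : PosCapital where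
  G := fun n => (S.G n).scale a
  c := fun n => a * S.c n
  c_pos := fun n => mul_pos ha (S.c_pos n)
  c_summable := S.c_summable.mul_left a
  nonneg := by
    intro n t ω
    rw [elemCapital_scale]
    exact mul_nonneg ha.le (S.nonneg n t ω)

theorem PosCapital.scale_value (S : PosCapital) (a : ℝ) (ha : 0 < a) (t : ℝ≥0) (ω : Omega) :
    (S.scale a ha).value t ω = ENNReal.ofReal a * S.value t ω := by
  unfold PosCapital.value
  rw [← ENNReal.tsum_mul_left]
  refine tsum_congr fun n => ?_
  rw [← ENNReal.ofReal_mul ha.le, ← elemCapital_scale]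
  rfl

theorem PosCapital.scale_init (S : PosCapital) (a : ℝ) (ha : 0 < a) :
    (S.scale a ha).init = ENNReal.ofReal a * S.init := by
  unfold PosCapital.init
  rw [← ENNReal.tsum_mul_left]
  refine tsum_congr fun n => ?_
  rw [← ENNReal.ofReal_mul ha.le]
  rfl

theorem PosCapital.init_pos (S : PosCapital) : S.init ≠ 0 := by
  unfold PosCapital.init
  intro h
  have := ENNReal.tsum_eq_zero.1 h 0
  rw [ENNReal.ofReal_eq_zero] at this
  exact absurd (S.c_pos 0) (not_lt.2 this)

theorem tsum_unpair (f : ℕ → ℕ → ℝ≥0∞) :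
    ∑' n : ℕ, f n.unpair.1 n.unpair.2 = ∑' k, ∑' m, f k m := by
  rw [← ENNReal.tsum_prod (f := f)]
  exact Nat.pairEquiv.symm.tsum_eq (fun p : ℕ × ℕ => f p.1 p.2)

/-- Countable sums of positive capital processes. -/
noncomputable def PosCapital.sum (S : ℕ → PosCapital) (hS : ∑' k, (S k).init ≠ ⊤) :
    PosCapital where
  G := fun n => (S n.unpair.1).G n.unpair.2
  c := fun n => (S n.unpair.1).c n.unpair.2
  c_pos := fun n => (S n.unpair.1).c_pos n.unpair.2
  c_summable := by
    have h : ∑' n : ℕ, ENNReal.ofReal ((S n.unpair.1).c n.unpair.2) ≠ ⊤ := by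
      rw [tsum_unpair (fun k m => ENNReal.ofReal ((S k).c m))]
      exact hS
    refine (ENNReal.summable_toReal h).congr fun n => ?_
    exact ENNReal.toReal_ofReal ((S n.unpair.1).c_pos n.unpair.2).le
  nonneg := fun n => (S n.unpair.1).nonneg n.unpair.2

theorem PosCapital.sum_value (S : ℕ → PosCapital) (hS : ∑' k, (S k).init ≠ ⊤)
    (t : ℝ≥0) (ω : Omega) : (PosCapital.sum S hS).value t ω = ∑' k, (S k).value t ω :=
  tsum_unpair (fun k m => ENNReal.ofReal (elemCapital ((S k).G m) ((S k).c m) t ω))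

theorem PosCapital.sum_init (S : ℕ → PosCapital) (hS : ∑' k, (S k).init ≠ ⊤) :
    (PosCapital.sum S hS).init = ∑' k, (S k).init :=
  tsum_unpair (fun k m => ENNReal.ofReal ((S k).c m))

/-- a set `E ⊆ Ω` is null if and only if there exists a positive
capital process `S` with `S₀ = 1` such that `lim_{t→∞} S_t(ω) = ∞` on `E`. -/
theorem isNull_iff_exists_posCapital (E : Set Omega) :
    IsNull E ↔
      ∃ S : PosCapital, S.init = 1 ∧
        ∀ ω ∈ E, Tendsto (fun t : ℝ≥0 => S.value t ω) atTop (𝓝 (⊤ : ℝ≥0∞)) := by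
  constructor
  · intro hE
    have hE' : UpProb E = 0 := hE
    obtain ⟨ε, hε, hsum⟩ := ENNReal.exists_pos_sum_of_countable' (ε := 1) one_ne_zero ℕ
    have key : ∀ k, ∃ S : PosCapital, (∀ ω : Omega,
        E.indicator (fun _ => (1 : ℝ≥0∞)) ω ≤ liminf (fun t : ℝ≥0 => S.value t ω) atTop) ∧
        S.init < ε k := by
      intro k
      have hlt : UpProb E < ε k := by rw [hE']; exact hε k
      unfold UpProb at hlt
      obtain ⟨S, h1⟩ := iInf_lt_iff.1 hlt
      obtain ⟨h2, h3⟩ := iInf_lt_iff.1 h1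
      exact ⟨S, h2, h3⟩
    choose S hS hSi using key
    have hfin : ∑' k, (S k).init ≠ ⊤ :=
      ((ENNReal.tsum_le_tsum fun k => (hSi k).le).trans_lt
        (hsum.trans ENNReal.one_lt_top)).ne
    set T := PosCapital.sum S hfin with hT
    have hTi : T.init ≠ ⊤ := by rw [hT, PosCapital.sum_init]; exact hfin
    have hpos : 0 < T.init.toReal := ENNReal.toReal_pos T.init_pos hTi
    have hlim : ∀ ω ∈ E, Tendsto (fun t : ℝ≥0 => T.value t ω) atTop (𝓝 (⊤ : ℝ≥0∞)) := by
      intro ω hω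
      rw [ENNReal.tendsto_nhds_top_iff_nat]
      intro n
      have hev : ∀ k, ∀ᶠ t : ℝ≥0 in atTop, (2 : ℝ≥0∞)⁻¹ < (S k).value t ω := by
        intro k
        have h1 := hS k ω
        rw [Set.indicator_of_mem hω] at h1
        exact eventually_lt_of_lt_liminf (lt_of_lt_of_le (by norm_num) h1)
      have hall : ∀ᶠ t : ℝ≥0 in atTop, ∀ k ∈ Finset.range (2 * (n + 1)),
          (2 : ℝ≥0∞)⁻¹ < (S k).value t ω :=
        (Finset.eventually_all _).2 fun k _ => hev k
      filter_upwards [hall] with t ht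
      rw [hT, PosCapital.sum_value]
      calc (n : ℝ≥0∞) < ((n + 1 : ℕ) : ℝ≥0∞) := by exact_mod_cast Nat.lt_succ_self n
        _ = ∑ k ∈ Finset.range (2 * (n + 1)), (2 : ℝ≥0∞)⁻¹ := by
            rw [Finset.sum_const, Finset.card_range, nsmul_eq_mul, Nat.cast_mul, mul_comm,
              ← mul_assoc, Nat.cast_ofNat, ENNReal.inv_mul_cancel (by norm_num) (by norm_num),
              one_mul]
        _ ≤ ∑ k ∈ Finset.range (2 * (n + 1)), (S k).value t ω :=
            Finset.sum_le_sum fun k hk => (ht k hk).le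
        _ ≤ _ := ENNReal.sum_le_tsum _
    refine ⟨T.scale (T.init.toReal)⁻¹ (inv_pos.2 hpos), ?_, ?_⟩
    · rw [PosCapital.scale_init, ENNReal.ofReal_inv_of_pos hpos, ENNReal.ofReal_toReal hTi]
      exact ENNReal.inv_mul_cancel T.init_pos hTi
    · intro ω hω
      simp only [PosCapital.scale_value]
      have hne : ENNReal.ofReal (T.init.toReal)⁻¹ ≠ 0 :=
        (ENNReal.ofReal_pos.2 (inv_pos.2 hpos)).ne'
      have := ENNReal.Tendsto.const_mul (a := ENNReal.ofReal (T.init.toReal)⁻¹)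
        (hlim ω hω) (Or.inl ENNReal.top_ne_zero)
      rwa [ENNReal.mul_top hne] at this
  · rintro ⟨S, hS1, hS⟩
    refine le_antisymm (ENNReal.le_of_forall_pos_le_add ?_) bot_le
    intro ε hε _
    have hε' : (0 : ℝ) < ε := hε
    have hne : ENNReal.ofReal (ε : ℝ) ≠ 0 := (ENNReal.ofReal_pos.2 hε').ne'
    refine (iInf₂_le (S.scale ε hε') ?_).trans ?_
    · intro ω
      by_cases hω : ω ∈ E
      · have := ENNReal.Tendsto.const_mul (a := ENNReal.ofReal (ε : ℝ))
          (hS ω hω) (Or.inl ENNReal.top_ne_zero)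
        rw [ENNReal.mul_top hne] at this
        simp only [PosCapital.scale_value]
        rw [this.liminf_eq]
        exact le_top
      · rw [Set.indicator_of_notMem hω]
        exact bot_le
    · rw [PosCapital.scale_init, hS1, mul_one, zero_add, ENNReal.ofReal_coe_nnreal]

end GTP
end

section
/- Suppose P is a probability measure on (Ω, F_∞) under which the coordinate process S_t(ω) := ω(t) is a martingale with respect to the filtration (F_t), and E ∈ F_∞ satisfies P(E) = 1. Then UpProb(E) = 1. -/
open Filter Topology MeasureTheory
open scoped ENNReal NNReal

namespace GTP

/-- The σ-algebra `F_∞ := σ(∪_t F_t)`. -/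
def Finfty : MeasurableSpace Omega := ⨆ t : ℝ≥0, F t

lemma F_mono : Monotone F := fun s t hst =>
  iSup_le fun u => le_iSup_of_le ⟨u.1, u.2.trans hst⟩ le_rfl

/-- `(F t)` as a filtration on `(Ω, F_∞)`. -/
def natFiltration : MeasureTheory.Filtration ℝ≥0 Finfty where
  seq := F
  mono' := F_mono
  le' := fun t => le_iSup F t

/-- The discretization from above, capped at `t`. -/
noncomputable def disc (t : ℝ≥0) (m : ℕ) (s : ℝ≥0) : ℝ≥0 :=
  min ((⌈s * (m + 1)⌉₊ : ℝ≥0) / (m + 1)) t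

lemma le_disc {t s : ℝ≥0} (m : ℕ) (hs : s ≤ t) : s ≤ disc t m s := by
  refine le_min ?_ hs
  rw [le_div_iff₀ (by positivity)]
  exact Nat.le_ceil _

lemma disc_le (t s : ℝ≥0) (m : ℕ) : disc t m s ≤ t := min_le_right _ _

lemma disc_le_add (t s : ℝ≥0) (m : ℕ) : disc t m s ≤ s + 1 / (m + 1) := by
  refine (min_le_left _ _).trans ?_
  rw [div_le_iff₀ (by positivity), add_mul, one_div, inv_mul_cancel₀ (by positivity)]
  exact (Nat.ceil_lt_add_one (zero_le)).le

lemma disc_tendsto {t s : ℝ≥0} (hs : s ≤ t) :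
    Tendsto (fun m : ℕ => disc t m s) atTop (𝓝 s) := by
  have h1 : Tendsto (fun m : ℕ => s + 1 / ((m : ℝ≥0) + 1)) atTop (𝓝 (s + 0)) :=
    tendsto_const_nhds.add tendsto_one_div_add_atTop_nhds_zero_nat
  rw [add_zero] at h1
  exact tendsto_of_tendsto_of_tendsto_of_le_of_le tendsto_const_nhds h1
    (fun m => le_disc m hs) (fun m => disc_le_add t s m)

lemma disc_le_iff {t i : ℝ≥0} (hit : i < t) (m : ℕ) (s : ℝ≥0) :
    disc t m s ≤ i ↔ s ≤ (⌊i * (m + 1)⌋₊ : ℝ≥0) / (m + 1) := by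
  have hp : (0 : ℝ≥0) < m + 1 := by positivity
  rw [disc, min_le_iff, or_iff_left (not_le.2 hit), div_le_iff₀ hp, le_div_iff₀ hp,
    ← Nat.le_floor_iff (zero_le), Nat.ceil_le]

section Generic

variable {Ω : Type*} {m : MeasurableSpace Ω} {μ : Measure Ω} [IsProbabilityMeasure μ]

lemma clip_le_iff {a : ℝ≥0∞} {t i : ℝ≥0} (hit : i < t) :
    (min a (t : ℝ≥0∞)).toNNReal ≤ i ↔ a ≤ i := by
  have h : min a (t : ℝ≥0∞) ≠ ⊤ := ne_top_of_le_ne_top ENNReal.coe_ne_top (min_le_right _ _)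
  rw [← ENNReal.coe_le_coe, ENNReal.coe_toNNReal h, min_le_iff, or_iff_left]
  exact not_le.2 (by exact_mod_cast hit)

lemma clip_le' (a : ℝ≥0∞) (t : ℝ≥0) : (min a (t : ℝ≥0∞)).toNNReal ≤ t := by
  have h : min a (t : ℝ≥0∞) ≠ ⊤ := ne_top_of_le_ne_top ENNReal.coe_ne_top (min_le_right _ _)
  rw [← ENNReal.coe_le_coe, ENNReal.coe_toNNReal h]
  exact min_le_right _ _

lemma key (𝓕 : Filtration ℝ≥0 m) (X : ℝ≥0 → Ω → ℝ) (hX : Martingale X 𝓕 μ)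
    (hc : ∀ ω, Continuous fun t => X t ω) (τ : Ω → ℝ≥0∞)
    (hτ : ∀ t : ℝ≥0, MeasurableSet[𝓕 t] {ω | τ ω ≤ (t : ℝ≥0∞)})
    (h : Ω → ℝ) (C : ℝ) (hb : ∀ ω, |h ω| ≤ C)
    (hm : ∀ B : Set ℝ, MeasurableSet B → ∀ t : ℝ≥0,
      MeasurableSet[𝓕 t] (h ⁻¹' B ∩ {ω | τ ω ≤ (t : ℝ≥0∞)})) (t : ℝ≥0) :
    Integrable (fun ω => h ω * (X t ω - X (min (τ ω) (t : ℝ≥0∞)).toNNReal ω)) μ ∧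
      ∫ ω, h ω * (X t ω - X (min (τ ω) (t : ℝ≥0∞)).toNNReal ω) ∂μ = 0 := by
  classical
  set s : Ω → ℝ≥0 := fun ω => (min (τ ω) (t : ℝ≥0∞)).toNNReal with hs
  have hst : ∀ ω, s ω ≤ t := fun ω => clip_le' _ _
  let g : Ω → ℝ := {ω | τ ω ≤ (t : ℝ≥0∞)}.indicator h
  have hgb : ∀ ω, ‖g ω‖ ≤ C := fun ω => (norm_indicator_le_norm_self h ω).trans (hb ω)
  have hgh : ∀ ω, h ω * (X t ω - X (s ω) ω) = g ω * (X t ω - X (s ω) ω) := by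
    intro ω
    by_cases hω : τ ω ≤ (t : ℝ≥0∞)
    · have : g ω = h ω := Set.indicator_of_mem (s := {ω | τ ω ≤ (t : ℝ≥0∞)}) hω h
      rw [this]
    · have : s ω = t := by
        change (min (τ ω) (t : ℝ≥0∞)).toNNReal = t
        rw [min_eq_right (not_le.1 hω).le]; simp
      rw [this]; simp
  have hgh' : (fun ω => h ω * (X t ω - X (min (τ ω) (t : ℝ≥0∞)).toNNReal ω)) =
      fun ω => g ω * (X t ω - X (s ω) ω) := funext hgh
  rw [hgh']
  -- `g` is `F_{τ ∧ t}` measurable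
  have hgm : ∀ B : Set ℝ, MeasurableSet B → ∀ i : ℝ≥0,
      MeasurableSet[𝓕 i] (g ⁻¹' B ∩ {ω | s ω ≤ i}) := by
    intro B hB i
    rcases lt_or_ge i t with hit | hti
    · have : g ⁻¹' B ∩ {ω | s ω ≤ i} = h ⁻¹' B ∩ {ω | τ ω ≤ (i : ℝ≥0∞)} := by
        ext ω
        simp only [Set.mem_inter_iff, Set.mem_preimage, Set.mem_ofPred_eq, hs, clip_le_iff hit]
        refine and_congr_left fun hω => ?_
        have hω' : τ ω ≤ (t : ℝ≥0∞) := hω.trans (by exact_mod_cast hit.le)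
        have : g ω = h ω := Set.indicator_of_mem (s := {ω | τ ω ≤ (t : ℝ≥0∞)}) hω' h
        rw [this]
      rw [this]; exact hm B hB i
    · have : g ⁻¹' B ∩ {ω | s ω ≤ i} = (h ⁻¹' B ∩ {ω | τ ω ≤ (t : ℝ≥0∞)}) ∪
          ({ω | (0 : ℝ) ∈ B} ∩ {ω | τ ω ≤ (t : ℝ≥0∞)}ᶜ) := by
        ext ω
        have := (hst ω).trans hti
        by_cases hω : τ ω ≤ (t : ℝ≥0∞)
        · simp [g, Set.indicator, hω, this]
        · simp [g, Set.indicator, hω, this]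
      rw [this]
      refine 𝓕.mono hti _ ?_
      exact (hm B hB t).union (MeasurableSet.inter (MeasurableSet.const _) (hτ t).compl)
  -- discretized stopping times
  let σ : ℕ → Ω → WithTop ℝ≥0 := fun k ω => ((disc t k (s ω) : ℝ≥0) : WithTop ℝ≥0)
  have hσ : ∀ k, IsStoppingTime 𝓕 (σ k) := by
    intro k i
    rcases lt_or_ge i t with hit | hti
    · have hj : (⌊i * (k + 1)⌋₊ : ℝ≥0) / (k + 1) ≤ i := by
        rw [div_le_iff₀ (by positivity)]; exact Nat.floor_le (zero_le)
      have : {ω | σ k ω ≤ i} =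
          {ω | τ ω ≤ (((⌊i * (k + 1)⌋₊ : ℝ≥0) / (k + 1) : ℝ≥0) : ℝ≥0∞)} := by
        ext ω
        simp only [σ, Set.mem_ofPred_eq, WithTop.coe_le_coe, disc_le_iff hit, hs,
          clip_le_iff (hj.trans_lt hit)]
      rw [this]
      exact 𝓕.mono hj _ (hτ _)
    · have : {ω | σ k ω ≤ i} = Set.univ := by
        ext ω
        exact iff_of_true (WithTop.coe_le_coe.2 ((disc_le t (s ω) k).trans hti)) trivial
      rw [this]; exact MeasurableSet.univ
  have hσt : ∀ k ω, σ k ω ≤ (t : WithTop ℝ≥0) := fun k ω =>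
    WithTop.coe_le_coe.2 (disc_le _ _ _)
  have hle : ∀ k, (hσ k).measurableSpace ≤ m := fun k => (hσ k).measurableSpace_le
  have hcount : ∀ k, (Set.range (σ k)).Countable := by
    intro k
    refine Set.Countable.mono (s₂ := Set.range fun n : ℕ =>
      ((min ((n : ℝ≥0) / (k + 1)) t : ℝ≥0) : WithTop ℝ≥0)) ?_ (Set.countable_range _)
    rintro _ ⟨ω, rfl⟩
    exact ⟨_, rfl⟩
  have hgσ : ∀ k, StronglyMeasurable[(hσ k).measurableSpace] g := by
    intro k
    refine Measurable.stronglyMeasurable ?_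
    intro B hB
    rw [IsStoppingTime.measurableSet]
    refine ⟨?_, fun i => ?_⟩
    · have : g ⁻¹' B = g ⁻¹' B ∩ {ω | s ω ≤ t} := by
        ext ω; simp [hst ω]
      rw [this]
      exact le_iSup (fun i => (𝓕 i)) t _ (hgm B hB t)
    · have : g ⁻¹' B ∩ {ω | σ k ω ≤ i} = (g ⁻¹' B ∩ {ω | s ω ≤ i}) ∩ {ω | σ k ω ≤ i} := by
        ext ω
        simp only [Set.mem_inter_iff, Set.mem_ofPred_eq, and_assoc]
        refine and_congr_right fun _ => ⟨fun h' => ⟨?_, h'⟩, fun h' => h'.2⟩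
        exact (le_disc k (hst ω)).trans (WithTop.coe_le_coe.1 h')
      rw [this]
      exact (hgm B hB i).inter (hσ k i)
  let Y : ℕ → Ω → ℝ := fun k ω => X (disc t k (s ω)) ω
  have hYc : ∀ k, Y k =ᵐ[μ] μ[X t | (hσ k).measurableSpace] := fun k =>
    hX.stoppedValue_ae_eq_condExp_of_le_const_of_countable_range (hσ k) (hσt k) (hcount k)
  have hUI : UniformIntegrable Y 1 μ :=
    (uniformIntegrable_congr_ae hYc).2 ((hX.integrable t).uniformIntegrable_condExp hle)
  have hlim : ∀ ω, Tendsto (fun k => Y k ω) atTop (𝓝 (X (s ω) ω)) := fun ω =>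
    ((hc ω).tendsto (s ω)).comp (disc_tendsto (hst ω))
  have hYL : MemLp (fun ω => X (s ω) ω) 1 μ :=
    hUI.memLp_of_ae_tendsto (ae_of_all _ hlim)
  have hL1 := tendsto_Lp_finite_of_tendsto_ae le_rfl ENNReal.one_ne_top hUI.1 hYL hUI.2.1
    (ae_of_all _ hlim)
  have hgae : AEStronglyMeasurable g μ := ((hgσ 0).mono (hle 0)).aestronglyMeasurable
  have hYi : ∀ k, Integrable (Y k) μ := fun k => memLp_one_iff_integrable.1 (hUI.memLp k)
  have hint : ∀ Z : Ω → ℝ, Integrable Z μ → Integrable (fun ω => g ω * (X t ω - Z ω)) μ :=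
    fun Z hZ => ((hX.integrable t).sub hZ).bdd_mul hgae (ae_of_all _ hgb)
  have hZ := memLp_one_iff_integrable.1 hYL
  refine ⟨hint _ hZ, ?_⟩
  have hzero : ∀ k, ∫ ω, g ω * (X t ω - Y k ω) ∂μ = 0 := by
    intro k
    have h1 := condExp_stronglyMeasurable_mul_of_bound (hle k) (hgσ k) (hX.integrable t) C
      (ae_of_all μ hgb)
    have h2 : ∫ ω, (g * X t) ω ∂μ = ∫ ω, g ω * Y k ω ∂μ := by
      rw [← integral_condExp (hle k)]
      refine integral_congr_ae ?_
      filter_upwards [h1, hYc k] with ω e1 e2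
      rw [e1, Pi.mul_apply, e2]
    simp_rw [mul_sub]
    rw [integral_sub ((hX.integrable t).bdd_mul hgae (ae_of_all _ hgb))
      ((hYi k).bdd_mul hgae (ae_of_all _ hgb)), ← h2]
    simp
  have hT : Tendsto (fun k => ∫ ω, g ω * (X t ω - Y k ω) ∂μ) atTop
      (𝓝 (∫ ω, g ω * (X t ω - X (s ω) ω) ∂μ)) := by
    refine tendsto_integral_of_L1' _ (hint _ hZ).aestronglyMeasurable
      (Eventually.of_forall fun k => hint _ (hYi k)) ?_
    refine tendsto_of_tendsto_of_tendsto_of_le_of_le tendsto_const_nhds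
      (h := fun k => ENNReal.ofReal C * eLpNorm (Y k - fun ω => X (s ω) ω) 1 μ) ?_
      (fun _ => zero_le) (fun k => ?_)
    · simpa using ENNReal.Tendsto.const_mul hL1 (Or.inr ENNReal.ofReal_ne_top)
    · refine eLpNorm_le_mul_eLpNorm_of_ae_le_mul (ae_of_all _ fun ω => ?_) 1
      have : (fun ω => g ω * (X t ω - Y k ω)) ω - g ω * (X t ω - X (s ω) ω)
        = - (g ω * (Y k ω - X (s ω) ω)) := by ring
      simp only [Pi.sub_apply]
      rw [this, norm_neg, norm_mul]
      exact mul_le_mul_of_nonneg_right (hgb ω) (norm_nonneg _)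
  simp_rw [hzero] at hT
  exact (tendsto_nhds_unique hT tendsto_const_nhds)

end Generic

/-- Partial sums of the capital process. -/
noncomputable def partCapital (G : ElemStrategy) (c : ℝ) (t : ℝ≥0) (N : ℕ) (ω : Omega) : ℝ :=
  c + ∑ n ∈ Finset.range N,
    G.h n ω * (ω.1 (clip (G.τ (n + 1)) t ω) - ω.1 (clip (G.τ n) t ω))

lemma τ_mono (G : ElemStrategy) (ω : Omega) : Monotone fun n => G.τ n ω :=
  monotone_nat_of_le_succ fun n => G.mono n ω

lemma partCapital_eq (G : ElemStrategy) (c : ℝ) (t : ℝ≥0) (N : ℕ) (ω : Omega) :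
    partCapital G c t N ω = elemCapital G c (clip (G.τ N) t ω) ω := by
  have h1 : ∀ n ≤ N, clip (G.τ n) (clip (G.τ N) t ω) ω = clip (G.τ n) t ω := by
    intro n hn
    rw [← ENNReal.coe_inj, coe_clip, coe_clip, coe_clip, ← min_assoc,
      min_eq_left (τ_mono G ω hn)]
  have h2 : ∀ n, N ≤ n → clip (G.τ n) (clip (G.τ N) t ω) ω = clip (G.τ N) t ω := by
    intro n hn
    rw [← ENNReal.coe_inj, coe_clip, coe_clip, ← min_assoc,
      min_eq_right (τ_mono G ω hn)]
  rw [partCapital, elemCapital, tsum_eq_sum (s := Finset.range N)]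
  · congr 1
    refine Finset.sum_congr rfl fun n hn => ?_
    have hn := Finset.mem_range.1 hn
    rw [h1 n hn.le, h1 (n + 1) hn]
  · intro n hn
    have hn : N ≤ n := by simpa using hn
    rw [h2 n hn, h2 (n + 1) (by omega)]; simp

lemma partCapital_tendsto (G : ElemStrategy) (c : ℝ) (t : ℝ≥0) (ω : Omega) :
    Tendsto (fun N => partCapital G c t N ω) atTop (𝓝 (elemCapital G c t ω)) := by
  refine tendsto_const_nhds.congr' ?_
  have h := (G.tendsto_top ω).eventually (lt_mem_nhds (ENNReal.coe_lt_top (r := t)))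
  filter_upwards [h] with N hN
  rw [partCapital_eq]
  congr 1
  rw [← ENNReal.coe_inj, coe_clip, min_eq_right hN.le]

lemma part_integral (P : @MeasureTheory.Measure Omega Finfty)
    (hP : @MeasureTheory.IsProbabilityMeasure Omega Finfty P)
    (hmart : MeasureTheory.Martingale (fun (t : ℝ≥0) (ω : Omega) => ω.1 t)
      natFiltration P) (G : ElemStrategy) (c : ℝ) (t : ℝ≥0) (N : ℕ) :
    Integrable (partCapital G c t N) P ∧ ∫ ω, partCapital G c t N ω ∂P = c := by
  have hstep : ∀ n,
      Integrable (fun ω : Omega =>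
        G.h n ω * (ω.1 (clip (G.τ (n + 1)) t ω) - ω.1 (clip (G.τ n) t ω))) P ∧
      ∫ ω : Omega, G.h n ω * (ω.1 (clip (G.τ (n + 1)) t ω) - ω.1 (clip (G.τ n) t ω)) ∂P = 0 := by
    intro n
    obtain ⟨C, hC⟩ := G.h_bdd n
    obtain ⟨i1, e1⟩ := key natFiltration _ hmart (fun ω => ω.2) (G.τ n) (G.stopping n)
      (G.h n) C hC (G.h_meas n) t
    obtain ⟨i2, e2⟩ := key natFiltration _ hmart (fun ω => ω.2) (G.τ (n + 1)) (G.stopping (n + 1))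
      (G.h n) C hC (fun B hB i => by
        have : G.h n ⁻¹' B ∩ {ω | G.τ (n + 1) ω ≤ (i : ℝ≥0∞)} =
          (G.h n ⁻¹' B ∩ {ω | G.τ n ω ≤ (i : ℝ≥0∞)}) ∩ {ω | G.τ (n + 1) ω ≤ (i : ℝ≥0∞)} := by
          ext ω
          simp only [Set.mem_inter_iff, Set.mem_ofPred_eq, and_assoc]
          exact and_congr_right fun _ => ⟨fun h' => ⟨(G.mono n ω).trans h', h'⟩, fun h' => h'.2⟩
        rw [this]
        exact MeasurableSet.inter (G.h_meas n B hB i) (G.stopping (n + 1) i)) t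
    have hfun : (fun ω : Omega =>
        G.h n ω * (ω.1 (clip (G.τ (n + 1)) t ω) - ω.1 (clip (G.τ n) t ω))) =
        fun ω : Omega => G.h n ω * (ω.1 t - ω.1 (min (G.τ n ω) (t : ℝ≥0∞)).toNNReal) -
          G.h n ω * (ω.1 t - ω.1 (min (G.τ (n + 1) ω) (t : ℝ≥0∞)).toNNReal) := by
      funext ω
      simp only [clip]
      ring
    rw [hfun]
    refine ⟨i1.sub i2, ?_⟩
    rw [integral_sub i1 i2, e1, e2, sub_zero]
  have hsum : Integrable (fun ω : Omega => ∑ n ∈ Finset.range N,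
      G.h n ω * (ω.1 (clip (G.τ (n + 1)) t ω) - ω.1 (clip (G.τ n) t ω))) P :=
    integrable_finsetSum _ fun n _ => (hstep n).1
  refine ⟨(integrable_const c).add hsum, ?_⟩
  simp only [partCapital]
  rw [integral_add (integrable_const c) hsum, integral_finsetSum _ fun n _ => (hstep n).1,
    Finset.sum_eq_zero fun n _ => (hstep n).2]
  simp

lemma elem_lintegral (P : @MeasureTheory.Measure Omega Finfty)
    (hP : @MeasureTheory.IsProbabilityMeasure Omega Finfty P)
    (hmart : MeasureTheory.Martingale (fun (t : ℝ≥0) (ω : Omega) => ω.1 t)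
      natFiltration P) (G : ElemStrategy) (c : ℝ)
    (hnn : ∀ t ω, 0 ≤ elemCapital G c t ω) (t : ℝ≥0) :
    AEMeasurable (fun ω => ENNReal.ofReal (elemCapital G c t ω)) P ∧
    ∫⁻ ω, ENNReal.ofReal (elemCapital G c t ω) ∂P ≤ ENNReal.ofReal c := by
  letI : MeasurableSpace Omega := Finfty
  have hI := part_integral P hP hmart G c t
  have hmeas : ∀ N, AEMeasurable (fun ω => ENNReal.ofReal (partCapital G c t N ω)) P :=
    fun N => (hI N).1.aestronglyMeasurable.aemeasurable.ennreal_ofReal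
  have hlim : ∀ ω, Tendsto (fun N => ENNReal.ofReal (partCapital G c t N ω)) atTop
      (𝓝 (ENNReal.ofReal (elemCapital G c t ω))) := fun ω =>
    ENNReal.tendsto_ofReal (partCapital_tendsto G c t ω)
  refine ⟨aemeasurable_of_tendsto_metrizable_ae' hmeas (ae_of_all _ hlim), ?_⟩
  have hval : ∀ N, ∫⁻ ω, ENNReal.ofReal (partCapital G c t N ω) ∂P = ENNReal.ofReal c := by
    intro N
    rw [← ofReal_integral_eq_lintegral_ofReal (hI N).1, (hI N).2]
    exact ae_of_all _ fun ω => by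
      rw [partCapital_eq]; exact hnn _ _
  calc ∫⁻ ω, ENNReal.ofReal (elemCapital G c t ω) ∂P
      = ∫⁻ ω, liminf (fun N => ENNReal.ofReal (partCapital G c t N ω)) atTop ∂P :=
        lintegral_congr fun ω => (hlim ω).liminf_eq.symm
    _ ≤ liminf (fun N => ∫⁻ ω, ENNReal.ofReal (partCapital G c t N ω) ∂P) atTop :=
        lintegral_liminf_le' hmeas
    _ = ENNReal.ofReal c := by simp [hval]

/-- The strategy that never trades. -/
noncomputable def trivStrategy : ElemStrategy where
  τ := fun n _ => (n : ℝ≥0∞)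
  stopping := fun n t => MeasurableSet.const _
  mono := fun n ω => by exact_mod_cast n.le_succ
  tendsto_top := fun ω => ENNReal.tendsto_nat_nhds_top
  h := fun _ _ => 0
  h_bdd := fun n => ⟨0, fun ω => by simp⟩
  h_meas := fun n B hB t => MeasurableSet.inter (MeasurableSet.const _) (MeasurableSet.const _)

lemma triv_capital (c : ℝ) (t : ℝ≥0) (ω : Omega) : elemCapital trivStrategy c t ω = c := by
  simp [elemCapital, trivStrategy]

/-- The capital process constantly equal to one. -/
noncomputable def unitCapital : PosCapital where
  G := fun _ => trivStrategy
  c := fun n => 1 / 2 / 2 ^ n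
  c_pos := fun n => by positivity
  c_summable := summable_geometric_two' 1
  nonneg := fun n t ω => by rw [triv_capital]; positivity

lemma unit_init : unitCapital.init = 1 := by
  rw [PosCapital.init, ← ENNReal.ofReal_tsum_of_nonneg (fun n => (unitCapital.c_pos n).le)
    unitCapital.c_summable]
  have : ∑' n, unitCapital.c n = 1 := tsum_geometric_two' 1
  rw [this, ENNReal.ofReal_one]

lemma unit_value (t : ℝ≥0) (ω : Omega) : unitCapital.value t ω = 1 := by
  rw [← unit_init, PosCapital.value, PosCapital.init]
  exact tsum_congr fun n => by
    rw [show unitCapital.G n = trivStrategy from rfl, triv_capital]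

/-- if `P` is a probability measure on `(Ω, F_∞)` making the
coordinate process `S_t(ω) := ω(t)` a martingale w.r.t. `(F_t)`, and `P(E) = 1`,
then `UpProb(E) = 1`. -/
theorem upProb_eq_one_of_martingale_measure
    (P : @MeasureTheory.Measure Omega Finfty)
    (hP : @MeasureTheory.IsProbabilityMeasure Omega Finfty P)
    (hmart : MeasureTheory.Martingale (fun (t : ℝ≥0) (ω : Omega) => ω.1 t)
      natFiltration P)
    (E : Set Omega) (hE : MeasurableSet[Finfty] E) (hPE : P E = 1) :
    UpProb E = 1 := by
  refine le_antisymm ?_ ?_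
  · refine (iInf₂_le unitCapital fun ω => ?_).trans unit_init.le
    simp only [unit_value, liminf_const]
    exact Set.indicator_le_self' (fun _ _ => zero_le) ω
  · letI : MeasurableSpace Omega := Finfty
    refine le_iInf₂ fun S hS => ?_
    have hel := fun k t => elem_lintegral P hP hmart (S.G k) (S.c k) (S.nonneg k) t
    have hmeas : ∀ n : ℕ, AEMeasurable (fun ω => S.value (n : ℝ≥0) ω) P := fun n =>
      AEMeasurable.tsum fun k => (hel k n).1
    have hint : ∀ n : ℕ, ∫⁻ ω, S.value (n : ℝ≥0) ω ∂P ≤ S.init := by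
      intro n
      simp only [PosCapital.value, PosCapital.init]
      rw [lintegral_tsum fun k => (hel k n).1]
      exact ENNReal.tsum_le_tsum fun k => (hel k n).2
    calc (1 : ℝ≥0∞) = ∫⁻ ω, E.indicator (fun _ => (1 : ℝ≥0∞)) ω ∂P := by
          rw [lintegral_indicator hE]; simp [hPE]
      _ ≤ ∫⁻ ω, liminf (fun n : ℕ => S.value (n : ℝ≥0) ω) atTop ∂P := by
          refine lintegral_mono fun ω => (hS ω).trans ?_
          exact (tendsto_natCast_atTop_atTop (R := ℝ≥0)).liminf_le_liminf_comp
      _ ≤ liminf (fun n : ℕ => ∫⁻ ω, S.value (n : ℝ≥0) ω ∂P) atTop :=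
          lintegral_liminf_le' hmeas
      _ ≤ liminf (fun _ : ℕ => S.init) atTop := liminf_le_liminf (Eventually.of_forall hint)
      _ = S.init := liminf_const _

end GTP
end
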